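/- arXiv:0710.1127 — 7 statements merged into one kernel-verified Lean document; each statement's English description precedes it below -/
import Mathlib

section
/- For every real number x with |x| < 2π and x ≠ 0, the logarithm of (e^x − 1)/x has the convergent power series expansion log((e^x − 1)/x) = Σ_{n=1}^∞ (B(n)/(n!·n)) x^n, where B(n) denotes the Bernoulli numbers with the convention B(1) = +1/2 (i.e., Mathlib's bernoulli' n). -/
open Real

/-- Coefficient of the exponential generating function. -/
noncomputable def bcoef (n : ℕ) : ℝ := ((bernoulli' n : ℚ) : ℝ) / (Nat.factorial n : ℝ)

lemma bcoef_bound (n : ℕ) : |bcoef n| * (2 * π) ^ n ≤ 4 := by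
  have hpi := Real.pi_lt_d2
  have hpi0 := Real.pi_pos
  rcases Nat.even_or_odd' n with ⟨k, rfl | rfl⟩
  · rcases Nat.eq_zero_or_pos k with rfl | hk
    · simp [bcoef]
    · have h1 := hasSum_zeta_nat hk.ne'
      have h2 := hasSum_zeta_two
      have hle := hasSum_le (f := fun n : ℕ => 1 / (n : ℝ) ^ (2 * k)) (fun n => by
        rcases Nat.eq_zero_or_pos n with rfl | hn
        · simp [hk.ne']
        · have : (1 : ℝ) ≤ n := by exact_mod_cast hn
          have : (n : ℝ) ^ 2 ≤ (n : ℝ) ^ (2 * k) := pow_le_pow_right₀ this (by omega)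
          exact one_div_le_one_div_of_le (by positivity) this) h1 h2
      have h0 := h1.nonneg (fun n => by positivity)
      have key : |bcoef (2 * k)| * (2 * π) ^ (2 * k) =
          2 * |(-1 : ℝ) ^ (k + 1) * (2 : ℝ) ^ (2 * k - 1) * π ^ (2 * k) *
        bernoulli (2 * k) / (Nat.factorial (2 * k))| := by
        rw [bcoef, ← bernoulli_eq_bernoulli'_of_ne_one (by omega)]
        have : (2 * π) ^ (2 * k) = 2 * 2 ^ (2 * k - 1) * π ^ (2 * k) := by
          rw [mul_pow, ← pow_succ' (2 : ℝ), Nat.sub_add_cancel (by omega)]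
        rw [this]
        simp only [abs_mul, abs_div, abs_pow, abs_neg, abs_one, one_pow, Nat.abs_cast, Nat.abs_ofNat,
          abs_of_pos hpi0]
        ring
      rw [key, abs_of_nonneg h0]
      nlinarith
  · rcases Nat.eq_zero_or_pos k with rfl | hk
    · simp [bcoef, bernoulli'_one]
      linarith
    · rw [bcoef, bernoulli'_eq_zero_of_odd ⟨k, rfl⟩ (by omega)]
      simp

lemma bcoef_le (n : ℕ) : |bcoef n| ≤ 4 / (2 * π) ^ n := by
  rw [le_div_iff₀ (by positivity)]
  exact bcoef_bound n

lemma summable_bcoef {r : ℝ} (h0 : 0 ≤ r) (hr : r < 2 * π) :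
    Summable fun n => |bcoef n| * r ^ n := by
  have : Summable fun n : ℕ => 4 * (r / (2 * π)) ^ n :=
    (summable_geometric_of_lt_one (by positivity) ((div_lt_one (by positivity)).2 hr)).mul_left 4
  refine this.of_nonneg_of_le (fun n => by positivity) fun n => ?_
  calc _ ≤ 4 / (2 * π) ^ n * r ^ n := by gcongr; exact bcoef_le n
    _ = _ := by rw [div_pow]; ring

lemma summable_bcoef_succ {r : ℝ} (h0 : 0 ≤ r) (hr : r < 2 * π) :
    Summable fun n => |bcoef (n + 1)| * r ^ n := by
  have : Summable fun n : ℕ => 4 * (r / (2 * π)) ^ n :=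
    (summable_geometric_of_lt_one (by positivity) ((div_lt_one (by positivity)).2 hr)).mul_left 4
  refine this.of_nonneg_of_le (fun n => by positivity) fun n => ?_
  have h1 : (1 : ℝ) ≤ 2 * π := by linarith [Real.pi_gt_three]
  calc _ ≤ 4 / (2 * π) ^ (n + 1) * r ^ n := by gcongr; exact bcoef_le _
    _ ≤ 4 / (2 * π) ^ n * r ^ n := by
      gcongr
      · omega
    _ = _ := by rw [div_pow]; ring

lemma bcoef_gen {y : ℝ} (hy : |y| < 2 * π) :
    (∑' n, bcoef n * y ^ n) * (Real.exp y - 1) = y * Real.exp y := by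
  have hexp : HasSum (fun n : ℕ => PowerSeries.coeff n (PowerSeries.exp ℝ) * y ^ n)
      (Real.exp y) := by
    have := NormedSpace.expSeries_div_hasSum_exp (𝔸 := ℝ) y
    rw [← Real.exp_eq_exp_ℝ] at this
    convert! this using 2 with n
    simp [PowerSeries.coeff_exp]
    ring
  have hexp1 : HasSum (fun n : ℕ => PowerSeries.coeff n (PowerSeries.exp ℝ - 1) * y ^ n)
      (Real.exp y - 1) := by
    have h1 := hexp.sub (hasSum_ite_eq 0 (1 : ℝ))
    convert! h1 using 2 with n
    simp only [map_sub, PowerSeries.coeff_one]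
    split_ifs with h <;> simp [h]
  have hX : HasSum (fun n : ℕ => PowerSeries.coeff n (PowerSeries.X * PowerSeries.exp ℝ) * y ^ n)
      (y * Real.exp y) := by
    rw [← hasSum_nat_add_iff' 1]
    simp only [Finset.range_one, Finset.sum_singleton, PowerSeries.coeff_succ_X_mul]
    convert! hexp.mul_left y using 1
    · ext n; ring
    · simp
  rw [← hexp1.tsum_eq, tsum_mul_tsum_eq_tsum_sum_antidiagonal_of_summable_norm, ← hX.tsum_eq]
  · congr 1
    ext n
    rw [← bernoulli'PowerSeries_mul_exp_sub_one, PowerSeries.coeff_mul, Finset.sum_mul]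
    refine Finset.sum_congr rfl fun p hp => ?_
    rw [← Finset.HasAntidiagonal.mem_antidiagonal.1 hp, pow_add]
    simp only [bernoulli'PowerSeries, PowerSeries.coeff_mk, bcoef, eq_ratCast]
    push_cast
    ring
  · simpa [abs_mul, abs_pow] using summable_bcoef (abs_nonneg y) hy
  · exact hexp1.summable.norm

lemma summable_F {y : ℝ} (hy : |y| < 2 * π) :
    Summable fun n : ℕ => bcoef (n + 1) / (n + 1) * y ^ (n + 1) := by
  refine .of_norm_bounded ((summable_nat_add_iff 1).2 (summable_bcoef (abs_nonneg y) hy)) fun n => ?_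
  rw [norm_mul, norm_div, norm_pow, Real.norm_eq_abs, Real.norm_eq_abs y]
  gcongr
  apply div_le_self (abs_nonneg _)
  rw [Real.norm_of_nonneg (by positivity)]
  linarith [(Nat.cast_nonneg n : (0 : ℝ) ≤ n)]

lemma hasDerivAt_F {y : ℝ} (hy : |y| < 2 * π) :
    HasDerivAt (fun z : ℝ => ∑' n : ℕ, bcoef (n + 1) / (n + 1) * z ^ (n + 1))
      (∑' n : ℕ, bcoef (n + 1) * y ^ n) y := by
  obtain ⟨r, hr1, hr2⟩ := exists_between hy
  have hr0 : 0 < r := (abs_nonneg y).trans_lt hr1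
  refine hasDerivAt_tsum_of_isPreconnected (t := Metric.ball 0 r) (y₀ := 0)
    (g := fun (n : ℕ) (z : ℝ) => bcoef (n + 1) / (n + 1) * z ^ (n + 1))
    (g' := fun n z => bcoef (n + 1) * z ^ n)
    (summable_bcoef_succ hr0.le hr2) Metric.isOpen_ball
    (convex_ball 0 r).isPreconnected (fun n z _ => ?_) (fun n z hz => ?_) (by simpa) ?_ (by simpa)
  · have := (hasDerivAt_pow (n + 1) z).const_mul (bcoef (n + 1) / (n + 1))
    convert! this using 1
    have : (n : ℝ) + 1 ≠ 0 := by positivity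
    push_cast
    field_simp
  · have hz : |z| < r := by simpa using hz
    rw [norm_mul, norm_pow, Real.norm_eq_abs, Real.norm_eq_abs]
    gcongr
  · exact summable_F (by simpa using Real.pi_pos)

lemma dslope_exp_pos (y : ℝ) : 0 < dslope Real.exp 0 y := by
  rcases lt_trichotomy y 0 with h | rfl | h
  · rw [dslope_of_ne _ h.ne, slope_def_field]
    exact div_pos_of_neg_of_neg (by simpa using h) (by linarith)
  · simp
  · rw [dslope_of_ne _ h.ne', slope_def_field]
    exact div_pos (by simpa using h) (by linarith)

lemma hasDerivAt_diff {y : ℝ} (hy : |y| < 2 * π) (hy0 : y ≠ 0) :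
    HasDerivAt (fun z : ℝ => Real.log (dslope Real.exp 0 z) -
      ∑' n : ℕ, bcoef (n + 1) / (n + 1) * z ^ (n + 1)) 0 y := by
  have hE : Real.exp y - 1 ≠ 0 := by
    rw [sub_ne_zero]; simpa using hy0
  have h1 : HasDerivAt (fun z : ℝ => (Real.exp z - 1) / z)
      ((Real.exp y * y - (Real.exp y - 1) * 1) / y ^ 2) y :=
    ((Real.hasDerivAt_exp y).sub_const 1).div (hasDerivAt_id y) hy0
  have h2 : HasDerivAt (fun z : ℝ => dslope Real.exp 0 z)
      ((Real.exp y * y - (Real.exp y - 1) * 1) / y ^ 2) y := by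
    refine h1.congr_of_eventuallyEq ?_
    filter_upwards [isOpen_ne.mem_nhds hy0] with z hz
    rw [dslope_of_ne _ hz, slope_def_field]
    simp
  have h3 := (h2.log (dslope_exp_pos y).ne').sub (hasDerivAt_F hy)
  convert! h3 using 1
  rw [dslope_of_ne _ hy0, slope_def_field]
  have hg := bcoef_gen hy
  have hs : Summable fun n => bcoef n * y ^ n :=
    .of_norm (by simpa [abs_mul, abs_pow] using summable_bcoef (abs_nonneg y) hy)
  have hS : ∑' n, bcoef n * y ^ n = 1 + y * ∑' n, bcoef (n + 1) * y ^ n := by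
    rw [hs.tsum_eq_zero_add, ← tsum_mul_left]
    congr 1
    · simp [bcoef]
    · congr 1; ext n; ring
  rw [hS] at hg
  rw [Real.exp_zero, sub_zero, eq_comm, sub_eq_zero]
  field_simp
  linarith

/-- For every real `x` with `|x| < 2π` and `x ≠ 0`, one has the convergent power series
expansion `log((e^x − 1)/x) = Σ_{n=1}^∞ (B(n)/(n!·n)) x^n`, where `B(n) = bernoulli' n`
are the Bernoulli numbers with the convention `B(1) = +1/2`. -/
theorem log_expm1_div_hasSum (x : ℝ) (hx : |x| < 2 * Real.pi) (hx0 : x ≠ 0) :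
    HasSum (fun n : ℕ =>
      ((bernoulli' (n + 1) : ℚ) : ℝ) / ((Nat.factorial (n + 1) : ℝ) * (n + 1)) * x ^ (n + 1))
      (Real.log ((Real.exp x - 1) / x)) := by
  set f : ℝ → ℝ := fun z : ℝ => Real.log (dslope Real.exp 0 z) -
      ∑' n : ℕ, bcoef (n + 1) / (n + 1) * z ^ (n + 1) with hf
  have hcont : ∀ y : ℝ, |y| < 2 * π → ContinuousAt f y := fun y hy => by
    refine ContinuousAt.sub (ContinuousAt.log ?_ (dslope_exp_pos y).ne')
      (hasDerivAt_F hy).continuousAt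
    by_cases h : y = 0
    · subst h; exact continuousAt_dslope_same.2 Real.differentiableAt_exp
    · exact (continuousAt_dslope_of_ne h).2 Real.continuous_exp.continuousAt
  have h0 : f 0 = 0 := by simp [hf]
  have hfx : f x = 0 := by
    obtain ⟨hl, hr⟩ := abs_lt.1 hx
    rcases lt_or_gt_of_ne hx0 with h | h
    · obtain ⟨c, hc, he⟩ := exists_hasDerivAt_eq_slope f (fun _ => 0) h
        (fun y hy => (hcont y (abs_lt.2 ⟨by linarith [hy.1], by
          linarith [hy.2, Real.pi_pos]⟩)).continuousWithinAt)
        (fun y hy => hasDerivAt_diff (abs_lt.2 ⟨by linarith [hy.1], by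
          linarith [hy.2, Real.pi_pos]⟩) hy.2.ne)
      rw [eq_comm, div_eq_zero_iff] at he
      rcases he with he | he <;> linarith
    · obtain ⟨c, hc, he⟩ := exists_hasDerivAt_eq_slope f (fun _ => 0) h
        (fun y hy => (hcont y (abs_lt.2 ⟨by linarith [hy.1, Real.pi_pos], by
          linarith [hy.2]⟩)).continuousWithinAt)
        (fun y hy => hasDerivAt_diff (abs_lt.2 ⟨by linarith [hy.1, Real.pi_pos], by
          linarith [hy.2]⟩) hy.1.ne')
      rw [eq_comm, div_eq_zero_iff] at he
      rcases he with he | he <;> linarith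
  have hs := (summable_F hx).hasSum
  have he : Real.log ((Real.exp x - 1) / x) =
      ∑' n : ℕ, bcoef (n + 1) / (n + 1) * x ^ (n + 1) := by
    rw [hf] at hfx
    simp only [dslope_of_ne _ hx0, slope_def_field, Real.exp_zero, sub_zero] at hfx
    linarith
  rw [he]
  convert! hs using 2 with n
  rw [bcoef, div_div]
end

section
/- Define A_n = Σ_{k=1}^{n} (B(k)/(k!·k))·(B(n−k)/(n−k)!) for n ≥ 1, where B(m) are the Bernoulli numbers with B(1) = +1/2. Then for every real number x with |x| < 2π and x ≠ 0, one has (x e^x/(e^x − 1))·log((e^x − 1)/x) = Σ_{n=1}^∞ A_n x^n, the series converging. -/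
open Real Finset

/-- The convolution `A_n = Σ_{k+j=n, k≥1, j≥0} (B(k)/(k!·k))·(B(j)/j!)` where `B` are the
Bernoulli numbers with the convention `B(1) = +1/2` (Mathlib's `bernoulli'`). -/
noncomputable def convA (n : ℕ) : ℝ :=
  ∑ k ∈ Finset.Icc 1 n,
    ((bernoulli' k : ℚ) : ℝ) / ((Nat.factorial k : ℝ) * k) *
      (((bernoulli' (n - k) : ℚ) : ℝ) / (Nat.factorial (n - k) : ℝ))

noncomputable def bb (k : ℕ) : ℝ := ((bernoulli' k : ℚ) : ℝ) / (Nat.factorial k : ℝ)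

lemma bb_bound (k : ℕ) : |bb k| * (2 * π) ^ k ≤ 4 := by
  rcases Nat.even_or_odd' k with ⟨m, rfl | rfl⟩
  · rcases Nat.eq_zero_or_pos m with rfl | hm
    · norm_num [bb]
    · have h1 := hasSum_zeta_nat hm.ne'
      have h2 := hasSum_zeta_two
      have h3 := hasSum_le (fun n => by
        show (1:ℝ) / (n:ℝ) ^ (2*m) ≤ 1 / (n:ℝ)^2
        rcases Nat.eq_zero_or_pos n with rfl | hn
        · simp [hm.ne']
        · have : (1:ℝ) ≤ n := by exact_mod_cast hn
          exact one_div_le_one_div_of_le (by positivity) (pow_le_pow_right₀ this (by omega))) h1 h2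
      have h4 := h1.nonneg (fun n => by positivity)
      have h5 : |bb (2*m)| * (2*π)^(2*m) = 2 * |((-1:ℝ) ^ (m + 1) * 2 ^ (2 * m - 1) * π ^ (2 * m) * bernoulli (2 * m) / (2 * m).factorial)| := by
        rw [bernoulli_eq_bernoulli'_of_ne_one (by omega)]
        obtain ⟨j, rfl⟩ : ∃ j, m = j + 1 := ⟨m - 1, by omega⟩
        have : 2 * (j+1) - 1 = 2*j+1 := by omega
        rw [this, bb]
        simp only [abs_mul, abs_div, abs_pow, abs_neg, abs_one, one_pow, Nat.abs_cast, abs_of_pos pi_pos, abs_two]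
        rw [mul_pow]
        ring
      rw [h5, abs_of_nonneg h4]
      have := pi_lt_d2
      nlinarith [pi_pos]
  · rcases Nat.eq_zero_or_pos m with rfl | hm
    · have := pi_lt_d2
      norm_num [bb, abs_of_pos]; linarith
    · rw [bb, bernoulli'_eq_zero_of_odd ⟨m, rfl⟩ (by omega)]; simp

lemma bb_le (k : ℕ) : |bb k| ≤ 4 / (2*π)^k := by
  rw [le_div_iff₀ (by positivity)]; exact bb_bound k

lemma bb_summable (x : ℝ) (hx : |x| < 2 * π) : Summable (fun k => ‖bb k * x ^ k‖) := by
  refine Summable.of_nonneg_of_le (fun _ => norm_nonneg _) (fun k => ?_)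
    ((summable_geometric_of_lt_one (r := |x| / (2*π)) (by positivity)
      ((div_lt_one (by positivity)).2 hx)).mul_left 4)
  rw [norm_mul, norm_pow, Real.norm_eq_abs, Real.norm_eq_abs, div_pow]
  calc _ ≤ 4 / (2*π)^k * |x|^k := by gcongr; exact bb_le k
    _ = _ := by ring

lemma aa_summable (x : ℝ) (hx : |x| < 2 * π) : Summable (fun k : ℕ => ‖bb k / k * x ^ k‖) := by
  refine Summable.of_nonneg_of_le (fun _ => norm_nonneg _) (fun k => ?_) (bb_summable x hx)
  rw [norm_mul, norm_mul, norm_div]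
  gcongr
  rcases Nat.eq_zero_or_pos k with rfl | hk
  · simp
  · apply div_le_self (norm_nonneg _)
    simp only [Real.norm_natCast]; exact_mod_cast hk

lemma bb_coeff (n : ℕ) : ∑ p ∈ antidiagonal n, bb p.1 * (if p.2 = 0 then 0 else 1 / (p.2.factorial : ℝ)) =
    if n = 0 then 0 else 1 / ((n-1).factorial : ℝ) := by
  have h := congrArg (PowerSeries.coeff n) (bernoulli'PowerSeries_mul_exp_sub_one ℝ)
  rw [PowerSeries.coeff_mul] at h
  rcases n with _ | n
  · simp
  · rw [PowerSeries.coeff_succ_X_mul] at h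
    simp only [PowerSeries.coeff_exp] at h
    simp only [Nat.add_sub_cancel, Nat.succ_ne_zero, if_false]
    convert! h using 1
    · refine Finset.sum_congr rfl fun p _ => ?_
      rw [bernoulli'PowerSeries]
      simp only [map_sub, PowerSeries.coeff_exp, PowerSeries.coeff_mk, PowerSeries.coeff_one, bb]
      split_ifs with h0 <;> simp [h0]
    · simp

lemma exp_hs (x : ℝ) : HasSum (fun n : ℕ => x ^ n / n.factorial) (exp x) := by
  rw [Real.exp_eq_exp_ℝ]; exact NormedSpace.expSeries_div_hasSum_exp x

lemma g_eq (x : ℝ) (hx : |x| < 2 * π) : (∑' k, bb k * x ^ k) * (exp x - 1) = x * exp x := by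
  set e : ℕ → ℝ := fun n => (if n = 0 then 0 else 1 / (n.factorial : ℝ)) * x ^ n with he
  have h1 : HasSum (fun n : ℕ => e (n+1)) (exp x - 1) := by
    have := (hasSum_nat_add_iff' 1).2 (exp_hs x)
    simp at this
    convert! this using 2 with n
    simp [he]; ring
  have h2 : HasSum e (exp x - 1) := by
    have := (hasSum_nat_add_iff (f := e) 1).1 h1
    simpa [he] using this
  have h3 : Summable (fun n => ‖e n‖) := h2.summable.norm
  rw [← h2.tsum_eq, tsum_mul_tsum_eq_tsum_sum_antidiagonal_of_summable_norm (bb_summable x hx) h3]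
  have h4 : ∀ n, ∑ p ∈ antidiagonal n, bb p.1 * x ^ p.1 * e p.2 =
      (if n = 0 then 0 else 1 / ((n-1).factorial : ℝ)) * x ^ n := by
    intro n
    rw [← bb_coeff, Finset.sum_mul]
    refine Finset.sum_congr rfl fun p hp => ?_
    rw [← mem_antidiagonal.1 hp, pow_add, he]; ring
  simp_rw [h4]
  have h5 := (exp_hs x).mul_left x
  refine HasSum.tsum_eq ?_
  rw [← hasSum_nat_add_iff' 1]
  simp
  convert! h5 using 2 with n
  ring

noncomputable def LL (x : ℝ) : ℝ := ∑' n : ℕ, bb (n+1) / ((n+1 : ℕ) : ℝ) * x ^ (n+1)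

lemma LL_deriv (x : ℝ) (hx : |x| < 2 * π) : HasDerivAt LL (∑' n : ℕ, bb (n+1) * x ^ n) x := by
  obtain ⟨r, hr1, hr2⟩ := exists_between hx
  have hr0 : 0 < r := (abs_nonneg x).trans_lt hr1
  refine hasDerivAt_tsum_of_isPreconnected (t := Metric.ball 0 r) (y₀ := 0)
    (u := fun n => 4 / (2*π) * (r / (2*π))^n)
    (g := fun (n : ℕ) (x : ℝ) => bb (n+1) / ((n+1 : ℕ) : ℝ) * x ^ (n+1))
    (g' := fun (n : ℕ) (x : ℝ) => bb (n+1) * x ^ n) ?_ Metric.isOpen_ball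
    (convex_ball _ _).isPreconnected ?_ ?_ (by simpa using hr0) ?_ (by simpa using hr1)
  · exact (summable_geometric_of_lt_one (by positivity)
      ((div_lt_one (by positivity)).2 hr2)).mul_left _
  · intro n y _
    have := (hasDerivAt_pow (n+1) y).const_mul (bb (n+1) / ((n+1 : ℕ) : ℝ))
    convert! this using 1
    have : ((n+1 : ℕ) : ℝ) ≠ 0 := by positivity
    field_simp
    simp
  · intro n y hy
    have hy : |y| < r := by simpa using hy
    rw [norm_mul, norm_pow, Real.norm_eq_abs, Real.norm_eq_abs, div_pow]
    calc _ ≤ 4 / (2*π)^(n+1) * r^n := by gcongr; exact bb_le _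
      _ = _ := by rw [pow_succ]; field_simp
  · simp [summable_zero]

lemma LL_mul (x : ℝ) (hx : |x| < 2 * π) :
    x * (∑' n : ℕ, bb (n+1) * x ^ n) = (∑' k, bb k * x ^ k) - 1 := by
  rw [(bb_summable x hx).of_norm.tsum_eq_zero_add, ← tsum_mul_left]
  have : bb 0 = 1 := by simp [bb]
  rw [this]; simp
  congr 1; ext n; ring

noncomputable def MM (x : ℝ) : ℝ := log ((exp x - 1) / x)

lemma expq_pos (x : ℝ) (hx : x ≠ 0) : 0 < (exp x - 1) / x := by
  rcases lt_or_gt_of_ne hx with h | h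
  · exact div_pos_of_neg_of_neg (by simpa using h) h
  · exact div_pos (by simpa using h) h

lemma MM_deriv (x : ℝ) (hx : |x| < 2 * π) (h0 : x ≠ 0) :
    HasDerivAt MM (∑' n : ℕ, bb (n+1) * x ^ n) x := by
  have h1 := (((Real.hasDerivAt_exp x).sub_const 1).div (hasDerivAt_id x) h0).log (expq_pos x h0).ne'
  convert! h1 using 1
  have h2 := LL_mul x hx
  have h3 := g_eq x hx
  have h4 : exp x - 1 ≠ 0 := fun h => (expq_pos x h0).ne' (by rw [h, zero_div])
  simp only [id, Pi.div_apply]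
  field_simp
  linear_combination (exp x - 1) * h2 + h3

lemma MM_cont0 : ContinuousAt MM 0 := by
  rw [← continuousWithinAt_compl_self]
  have h := (hasDerivAt_iff_tendsto_slope_zero.1 (Real.hasDerivAt_exp 0))
  have h2 := h.log (by simp)
  unfold ContinuousWithinAt MM
  simp at h2 ⊢
  convert! h2 using 2 with t
  ring_nf

lemma MM_eq (x : ℝ) (hx : |x| < 2 * π) (h0 : x ≠ 0) : MM x = LL x := by
  have hb : ∀ s ∈ Set.Icc (0:ℝ) 1, |s * x| < 2 * π := by
    intro s hs
    rw [abs_mul, abs_of_nonneg hs.1]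
    exact (mul_le_of_le_one_left (abs_nonneg x) hs.2).trans_lt hx
  have hd : ∀ s ∈ Set.Ioo (0:ℝ) 1, HasDerivAt (fun s => MM (s*x) - LL (s*x)) 0 s := by
    intro s hs
    have hs' := hb s ⟨hs.1.le, hs.2.le⟩
    have hm : HasDerivAt (fun s : ℝ => s * x) x s := by simpa using (hasDerivAt_id s).mul_const x
    have h1 := (MM_deriv (s*x) hs' (mul_ne_zero hs.1.ne' h0)).comp s hm
    have h2 := (LL_deriv (s*x) hs').comp s hm
    have h3 := h1.sub h2
    rw [sub_self] at h3
    exact h3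
  have hc : ContinuousOn (fun s => MM (s*x) - LL (s*x)) (Set.Icc 0 1) := by
    intro s hs
    apply ContinuousAt.continuousWithinAt
    have hm : ContinuousAt (fun s : ℝ => s * x) s := by fun_prop
    have h2 : ContinuousAt (fun s => LL (s*x)) s :=
      ContinuousAt.comp (f := fun s : ℝ => s * x) (LL_deriv (s*x) (hb s hs)).continuousAt hm
    refine ContinuousAt.sub ?_ h2
    refine ContinuousAt.comp (f := fun s : ℝ => s * x) (g := MM) ?_ hm
    rcases eq_or_ne s 0 with rfl | hs0
    · simpa using MM_cont0
    · exact (MM_deriv (s*x) (hb s hs) (mul_ne_zero hs0 h0)).continuousAt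
  obtain ⟨c, hc1, hc2⟩ := exists_hasDerivAt_eq_slope _ (fun _ => (0:ℝ)) one_pos hc hd
  have e1 : MM 0 = 0 := by simp [MM]
  have e2 : LL 0 = 0 := by simp [LL]
  simp [e1, e2] at hc2
  linarith

/-- For every real `x` with `|x| < 2π` and `x ≠ 0`, one has
`(x e^x/(e^x − 1))·log((e^x − 1)/x) = Σ_{n=1}^∞ A_n x^n`, the series converging. -/
theorem hasSum_convA (x : ℝ) (hx : |x| < 2 * Real.pi) (hx0 : x ≠ 0) :
    HasSum (fun n : ℕ => convA (n + 1) * x ^ (n + 1))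
      (x * Real.exp x / (Real.exp x - 1) * Real.log ((Real.exp x - 1) / x)) := by
  have h4 : exp x - 1 ≠ 0 := fun h => (expq_pos x hx0).ne' (by rw [h, zero_div])
  have e1 : x * Real.exp x / (Real.exp x - 1) = ∑' k, bb k * x ^ k := by
    rw [← g_eq x hx]; field_simp
  have e2 : Real.log ((Real.exp x - 1) / x) = ∑' k : ℕ, bb k / k * x ^ k := by
    rw [(aa_summable x hx).of_norm.tsum_eq_zero_add]
    simpa [MM, LL] using MM_eq x hx hx0
  have hs := (summable_norm_sum_mul_antidiagonal_of_summable_norm (aa_summable x hx) (bb_summable x hx)).of_norm.hasSum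
  rw [← tsum_mul_tsum_eq_tsum_sum_antidiagonal_of_summable_norm (aa_summable x hx) (bb_summable x hx)] at hs
  rw [e1, e2, mul_comm]
  have hA : ∀ n, ∑ p ∈ antidiagonal n, bb p.1 / p.1 * x ^ p.1 * (bb p.2 * x ^ p.2) = convA n * x ^ n := by
    intro n
    rw [Finset.Nat.sum_antidiagonal_eq_sum_range_succ_mk, convA, Finset.sum_mul,
      Finset.sum_range_succ']
    simp only [Nat.cast_zero, div_zero, zero_mul, add_zero]
    rw [← Finset.sum_image (f := fun k => bb k / (k:ℝ) * x ^ k * (bb (n-k) * x ^ (n-k))) (s := range n) (g := fun k => k + 1) (by simp)]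
    refine Finset.sum_congr ?_ ?_
    · ext k; simp only [mem_image, mem_range, mem_Icc]
      exact ⟨by rintro ⟨a, h, rfl⟩; omega, fun h => ⟨k-1, by omega, by omega⟩⟩
    · intro k hk
      have hk := (mem_Icc.1 hk).2
      rw [show x ^ n = x ^ k * x ^ (n-k) by rw [← pow_add]; congr 1; omega, bb, bb, div_div]
      ring
  simp_rw [hA] at hs
  have := (hasSum_nat_add_iff' 1).2 hs
  have h0 : convA 0 = 0 := by simp [convA]
  simpa [h0] using this
end

section
/- For every complex number s with Re(s) > 1, the integral ∫_0^∞ x^{s−1} e^{−x} log(1 − e^{−x})/(1 − e^{−x}) dx converges and equals −Γ(s) · Σ_{n=1}^∞ H_n/(n+1)^s, where Γ is the Gamma function and H_n is the n-th harmonic number. Equivalently, it equals −Γ(s)·(h(s) − ζ(s+1)), where h(s) = Σ_{n=1}^∞ H_n n^{−s} and ζ is the Riemann zeta function. -/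
open MeasureTheory Set Complex

lemma aux_gen (x : ℝ) (hx0 : 0 < x) (hx1 : x < 1) :
    HasSum (fun n : ℕ => -((harmonic (n + 1) : ℚ) : ℝ) * x ^ (n + 2))
      (x * Real.log (1 - x) / (1 - x)) := by
  have hab : |x| < 1 := by rwa [abs_of_pos hx0]
  have h1 := Real.hasSum_pow_div_log_of_abs_lt_one hab
  have h2 := hasSum_geometric_of_lt_one hx0.le hx1
  have n1 : Summable fun n : ℕ => ‖x ^ (n + 1) / ((n : ℝ) + 1)‖ := h1.summable.norm
  have n2 : Summable fun n : ℕ => ‖x ^ n‖ := h2.summable.norm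
  have h3 := hasSum_sum_range_mul_of_summable_norm n1 n2
  rw [h1.tsum_eq, h2.tsum_eq] at h3
  have h4 := h3.mul_left (-x)
  have e : x * Real.log (1 - x) / (1 - x) = -x * (-Real.log (1 - x) * (1 - x)⁻¹) := by
    rw [div_eq_mul_inv]
    ring
  rw [e]
  have ef : (fun n : ℕ => -((harmonic (n + 1) : ℚ) : ℝ) * x ^ (n + 2)) = fun n : ℕ =>
      -x * ∑ k ∈ Finset.range (n + 1), x ^ (k + 1) / ((k : ℝ) + 1) * x ^ (n - k) := by
    funext n
    simp only [harmonic]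
    push_cast
    rw [neg_mul, neg_mul, Finset.sum_mul, Finset.mul_sum]
    congr 1
    refine Finset.sum_congr rfl fun k hk => ?_
    have hk' : k ≤ n := by simpa [Nat.lt_succ_iff] using hk
    have : x ^ (n + 2) = x * (x ^ (k + 1) * x ^ (n - k)) := by
      rw [← pow_add, ← pow_succ']
      congr 1
      omega
    rw [this]
    field_simp
  rw [ef]
  exact h4

lemma aux_summable (σ : ℝ) (hσ : 1 < σ) :
    Summable fun n : ℕ => ((harmonic (n + 1) : ℚ) : ℝ) / ((n : ℝ) + 2) ^ σ := by
  obtain ⟨ε, hε⟩ : ∃ ε, ε = (σ - 1) / 2 := ⟨_, rfl⟩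
  have hε0 : 0 < ε := by rw [hε]; linarith
  have hs : Summable fun n : ℕ => (1 + 1 / ε) * (1 / ((n : ℝ) + 2) ^ (σ - ε)) := by
    apply Summable.mul_left
    have := (summable_nat_add_iff 2).2
      (Real.summable_one_div_nat_rpow.2 (show 1 < σ - ε by rw [hε]; linarith))
    simpa using this
  refine Summable.of_nonneg_of_le (fun n => ?_) (fun n => ?_) hs
  · have : (0 : ℝ) < ((harmonic (n + 1) : ℚ) : ℝ) := by
      exact_mod_cast harmonic_pos (Nat.succ_ne_zero n)
    positivity
  · have hp : (0 : ℝ) < (n : ℝ) + 2 := by positivity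
    have h1 := harmonic_le_one_add_log (n + 1)
    have h2 : Real.log ((n + 1 : ℕ) : ℝ) ≤ Real.log ((n : ℝ) + 2) := by
      apply Real.log_le_log
      · positivity
      · push_cast; linarith
    have h3 := Real.log_le_rpow_div hp.le hε0
    have h4 : (1 : ℝ) ≤ ((n : ℝ) + 2) ^ ε := Real.one_le_rpow (by linarith) hε0.le
    rw [Real.rpow_sub hp, one_div_div, ← mul_div_assoc]
    have hd : (0 : ℝ) < ((n : ℝ) + 2) ^ σ := by positivity
    rw [div_le_div_iff_of_pos_right hd]
    calc _ ≤ _ := h1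
      _ ≤ ((n : ℝ) + 2) ^ ε + ((n : ℝ) + 2) ^ ε / ε := by linarith
      _ = _ := by ring

noncomputable def auxF (t : ℝ) : ℂ :=
  ((Real.exp (-t) * Real.log (1 - Real.exp (-t)) / (1 - Real.exp (-t)) : ℝ) : ℂ)

lemma aux_mellin (s : ℂ) (hs : 1 < s.re) :
    HasSum (fun n : ℕ => Complex.Gamma s * (-((harmonic (n + 1) : ℚ) : ℂ)) /
      (((n : ℝ) + 2 : ℝ) : ℂ) ^ s) (mellin auxF s) := by
  refine hasSum_mellin (a := fun n : ℕ => (-((harmonic (n + 1) : ℚ) : ℂ)))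
    (p := fun n : ℕ => (n : ℝ) + 2) (fun i => Or.inr (by positivity)) (by linarith) ?_ ?_
  · intro t ht
    have ht : 0 < t := ht
    have h := aux_gen (Real.exp (-t)) (Real.exp_pos _) (by simpa using ht)
    have h' := Complex.hasSum_ofReal.2 h
    unfold auxF
    convert h' using 1
    ext n
    push_cast
    congr 1
    rw [← Complex.exp_nat_mul]
    push_cast
    congr 1
    ring
  · convert aux_summable s.re hs using 2 with n
    have : (0 : ℝ) < ((harmonic (n + 1) : ℚ) : ℝ) := by
      exact_mod_cast harmonic_pos (Nat.succ_ne_zero n)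
    rw [norm_neg, ← Complex.ofReal_ratCast, Complex.norm_real, Real.norm_of_nonneg this.le]

lemma aux_int (s : ℂ) (hs : 1 < s.re) :
    IntegrableOn (fun x : ℝ => (x : ℂ) ^ (s - 1) * auxF x) (Ioi 0) := by
  have hre : 1 < ((s.re : ℝ) : ℂ).re := by simpa using hs
  have h := aux_mellin (s.re : ℂ) hre
  have hsum := aux_summable s.re hs
  have hpos : 0 < ∑' n : ℕ, ((harmonic (n + 1) : ℚ) : ℝ) / ((n : ℝ) + 2) ^ s.re := by
    have hq (n : ℕ) : (0 : ℝ) < ((harmonic (n + 1) : ℚ) : ℝ) := by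
      exact_mod_cast harmonic_pos (Nat.succ_ne_zero n)
    refine hsum.tsum_pos (fun n => ?_) 0 ?_
    · have := hq n
      positivity
    · have := hq 0
      positivity
  have hne : mellin auxF (s.re : ℂ) ≠ 0 := by
    have h2 := (Complex.hasSum_ofReal.2 hsum.hasSum).mul_left (-Complex.Gamma (s.re : ℂ))
    have e : (fun n : ℕ => Complex.Gamma (s.re : ℂ) * (-((harmonic (n + 1) : ℚ) : ℂ)) /
        (((n : ℝ) + 2 : ℝ) : ℂ) ^ (s.re : ℂ)) = fun n : ℕ => -Complex.Gamma (s.re : ℂ) *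
        ((((harmonic (n + 1) : ℚ) : ℝ) / ((n : ℝ) + 2) ^ s.re : ℝ) : ℂ) := by
      funext n
      rw [Complex.ofReal_div, Complex.ofReal_cpow (by positivity), Complex.ofReal_ratCast]
      ring
    rw [e] at h
    rw [h.unique h2]
    refine mul_ne_zero (neg_ne_zero.2 ?_) ?_
    · exact Complex.Gamma_ne_zero_of_re_pos (by linarith)
    · exact_mod_cast hpos.ne'
  have hI : IntegrableOn (fun x : ℝ => (x : ℂ) ^ ((s.re : ℂ) - 1) * auxF x) (Ioi 0) := by
    by_contra hc
    apply hne
    unfold mellin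
    simpa [smul_eq_mul] using integral_undef hc
  refine Integrable.mono hI ?_ ?_
  · apply Measurable.aestronglyMeasurable
    unfold auxF
    fun_prop
  · refine (ae_restrict_iff' measurableSet_Ioi).2 (Filter.Eventually.of_forall fun x hx => ?_)
    rw [norm_mul, norm_mul, Complex.norm_cpow_eq_rpow_re_of_pos hx,
      Complex.norm_cpow_eq_rpow_re_of_pos hx]
    simp

lemma aux_tsum (s : ℂ) (hs : 1 < s.re) :
    (∑' n : ℕ, ((harmonic (n + 1) : ℚ) : ℂ) * ((n + 1 : ℕ) : ℂ) ^ (-s)) - riemannZeta (s + 1) =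
    ∑' n : ℕ, ((harmonic (n + 1) : ℚ) : ℂ) / ((n + 1 : ℕ) + 1 : ℂ) ^ s := by
  have hs1 : 1 < (s + 1).re := by simp; linarith
  have hz : Summable fun n : ℕ => 1 / ((n : ℂ) + 1) ^ (s + 1) := by
    have := (summable_nat_add_iff 1).2 (Complex.summable_one_div_nat_cpow.2 hs1)
    simpa using this
  have hh : Summable fun n : ℕ => ((harmonic (n + 1) : ℚ) : ℂ) / ((n + 1 : ℕ) + 1 : ℂ) ^ s := by
    have hg := Complex.Gamma_ne_zero_of_re_pos (show 0 < s.re by linarith)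
    have := (aux_mellin s hs).summable.mul_left (-(Complex.Gamma s)⁻¹)
    refine this.congr fun n => ?_
    have : (((n + 1 : ℕ) : ℂ) + 1) = (((n : ℝ) + 2 : ℝ) : ℂ) := by push_cast; ring
    rw [this]
    field_simp
  have hH : Summable fun n : ℕ => ((harmonic n : ℚ) : ℂ) / ((n : ℂ) + 1) ^ s :=
    (summable_nat_add_iff 1).1 hh
  have h0 := hH.tsum_eq_zero_add
  simp only [harmonic_zero, Rat.cast_zero, zero_div, zero_add] at h0
  rw [zeta_eq_tsum_one_div_nat_add_one_cpow hs1, ← h0, sub_eq_iff_eq_add, ← hH.tsum_add hz]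
  refine tsum_congr fun n => ?_
  have hn : (n : ℂ) + 1 ≠ 0 := by exact_mod_cast Nat.succ_ne_zero n
  rw [harmonic_succ, Complex.cpow_neg, Complex.cpow_add _ _ hn, Complex.cpow_one]
  push_cast
  field_simp


/-- For `Re(s) > 1`, the integral `∫_0^∞ x^{s−1} e^{−x} log(1 − e^{−x})/(1 − e^{−x}) dx`
converges and equals `−Γ(s) · Σ_{n=1}^∞ H_n/(n+1)^s`, equivalently `−Γ(s)·(h(s) − ζ(s+1))`
where `h(s) = Σ_{n=1}^∞ H_n n^{−s}`. -/
theorem integral_log_one_sub_exp (s : ℂ) (hs : 1 < s.re) :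
    IntegrableOn
      (fun x : ℝ => (x : ℂ) ^ (s - 1) * Real.exp (-x) *
        Real.log (1 - Real.exp (-x)) / (1 - Real.exp (-x))) (Ioi 0) ∧
    (∫ x : ℝ in Ioi 0, (x : ℂ) ^ (s - 1) * Real.exp (-x) *
        Real.log (1 - Real.exp (-x)) / (1 - Real.exp (-x)))
      = -Complex.Gamma s * ∑' n : ℕ, ((harmonic (n + 1) : ℚ) : ℂ) / ((n + 1 : ℕ) + 1 : ℂ) ^ s ∧
    (∫ x : ℝ in Ioi 0, (x : ℂ) ^ (s - 1) * Real.exp (-x) *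
        Real.log (1 - Real.exp (-x)) / (1 - Real.exp (-x)))
      = -Complex.Gamma s *
          ((∑' n : ℕ, ((harmonic (n + 1) : ℚ) : ℂ) * ((n + 1 : ℕ) : ℂ) ^ (-s))
            - riemannZeta (s + 1)) := by
  have hF : (fun x : ℝ => (x : ℂ) ^ (s - 1) * Real.exp (-x) *
        Real.log (1 - Real.exp (-x)) / (1 - Real.exp (-x))) =
      fun x : ℝ => (x : ℂ) ^ (s - 1) * auxF x := by
    ext x
    unfold auxF
    rw [Complex.ofReal_div, Complex.ofReal_mul, Complex.ofReal_sub, Complex.ofReal_one]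
    ring
  have hm : (∫ x : ℝ in Ioi 0, (x : ℂ) ^ (s - 1) * auxF x)
      = -Complex.Gamma s *
        ∑' n : ℕ, ((harmonic (n + 1) : ℚ) : ℂ) / ((n + 1 : ℕ) + 1 : ℂ) ^ s := by
    have h := (aux_mellin s hs).tsum_eq
    simp only [mellin, smul_eq_mul] at h
    rw [← h, ← tsum_mul_left]
    refine tsum_congr fun n => ?_
    have : (((n + 1 : ℕ) : ℂ) + 1) = (((n : ℝ) + 2 : ℝ) : ℂ) := by push_cast; ring
    rw [this]
    ring
  rw [hF, aux_tsum s hs]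
  exact ⟨aux_int s hs, hm, hm⟩
end

section
/- For every complex number s with Re(s) > 1, the integral ∫_0^∞ x^{s−1} e^{−x}/(1 − e^{−x}) · log((1 − e^{−x})/x) dx converges and equals −Γ(s)·( h(s) − ζ(s+1) + ψ(s)·ζ(s) + ζ′(s) ), where h(s) = Σ_{n=1}^∞ H_n n^{−s}, ψ(s) = Γ′(s)/Γ(s), Γ is the Gamma function, and ζ is the Riemann zeta function. -/
open MeasureTheory Set Complex

/-- The kernel `e^{-x}/(1-e^{-x})`. -/
noncomputable def gker (x : ℝ) : ℝ := Real.exp (-x) / (1 - Real.exp (-x))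

lemma exp_neg_lt_one_aux {x : ℝ} (hx : 0 < x) : Real.exp (-x) < 1 := by
  rw [Real.exp_lt_one_iff]; linarith

lemma gker_nonneg {x : ℝ} (hx : 0 < x) : 0 ≤ gker x :=
  div_nonneg (Real.exp_pos _).le (by linarith [exp_neg_lt_one_aux hx])

lemma mul_exp_neg_le {x : ℝ} : x * Real.exp (-x) ≤ 1 - Real.exp (-x) := by
  have h1 : x + 1 ≤ Real.exp x := Real.add_one_le_exp x
  have h2 : Real.exp x * Real.exp (-x) = 1 := by rw [← Real.exp_add]; simp
  nlinarith [Real.exp_pos (-x)]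

lemma gker_le_inv {x : ℝ} (hx : 0 < x) : gker x ≤ x⁻¹ := by
  have h1 := exp_neg_lt_one_aux hx
  rw [gker, div_le_iff₀ (by linarith), ← div_eq_inv_mul, le_div_iff₀ hx, mul_comm]
  exact mul_exp_neg_le

lemma gker_le_exp {x : ℝ} (hx : 1 ≤ x) : gker x ≤ 2 * Real.exp (-x) := by
  have h1 := exp_neg_lt_one_aux (by linarith : 0 < x)
  have h3 := mul_exp_neg_le (x := x)
  rw [gker, div_le_iff₀ (by linarith)]
  nlinarith [Real.exp_pos (-x)]

lemma gker_cont : ContinuousOn gker (Ioi 0) := by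
  intro x hx
  have h1 := exp_neg_lt_one_aux hx
  unfold gker
  refine ContinuousAt.continuousWithinAt ?_
  refine ContinuousAt.div (by fun_prop) (by fun_prop) (by linarith)

lemma gker_locInt : LocallyIntegrableOn (fun x : ℝ => (gker x : ℂ)) (Ioi 0) :=
  (Complex.continuous_ofReal.comp_continuousOn gker_cont).locallyIntegrableOn measurableSet_Ioi

lemma gker_top (a : ℝ) : (fun x : ℝ => (gker x : ℂ)) =O[Filter.atTop] (fun x : ℝ => x ^ (-a)) := by
  have h1 : (fun x : ℝ => (gker x : ℂ)) =O[Filter.atTop] (fun x : ℝ => Real.exp (-1 * x)) := by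
    refine Asymptotics.IsBigO.of_bound 2 ?_
    filter_upwards [Filter.eventually_ge_atTop (1 : ℝ)] with x hx
    rw [Complex.norm_real, Real.norm_of_nonneg (gker_nonneg (by linarith)),
      Real.norm_of_nonneg (Real.exp_pos _).le, neg_one_mul]
    exact gker_le_exp hx
  exact h1.trans (isLittleO_exp_neg_mul_rpow_atTop one_pos _).isBigO

lemma gker_bot : (fun x : ℝ => (gker x : ℂ)) =O[nhdsWithin 0 (Ioi 0)]
    (fun x : ℝ => x ^ (-(1 : ℝ))) := by
  refine Asymptotics.IsBigO.of_bound 1 ?_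
  filter_upwards [self_mem_nhdsWithin] with x hx
  have hx : 0 < x := hx
  rw [Complex.norm_real, Real.norm_of_nonneg (gker_nonneg hx), Real.rpow_neg_one,
    Real.norm_of_nonneg (by positivity), one_mul]
  exact gker_le_inv hx

lemma gker_conv {s : ℂ} (hs : 1 < s.re) : MellinConvergent (fun x : ℝ => (gker x : ℂ)) s :=
  mellinConvergent_of_isBigO_rpow gker_locInt (gker_top (s.re + 1)) (by linarith) gker_bot hs

lemma gker_deriv {s : ℂ} (hs : 1 < s.re) :
    MellinConvergent (fun x : ℝ => Real.log x • (gker x : ℂ)) s ∧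
    HasDerivAt (mellin (fun x : ℝ => (gker x : ℂ)))
      (mellin (fun x : ℝ => Real.log x • (gker x : ℂ)) s) s :=
  mellin_hasDerivAt_of_isBigO_rpow gker_locInt (gker_top (s.re + 1)) (by linarith) gker_bot hs

lemma summable_shift {r : ℝ} (hr : 1 < r) : Summable (fun n : ℕ => 1 / ((n : ℝ) + 1) ^ r) := by
  have := (summable_nat_add_iff 1).2 (Real.summable_one_div_nat_rpow.2 hr)
  simpa using this

lemma gker_mellin {s : ℂ} (hs : 1 < s.re) :
    mellin (fun x : ℝ => (gker x : ℂ)) s = Complex.Gamma s * riemannZeta s := by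
  have h := hasSum_mellin (a := fun _ : ℕ => (1 : ℂ)) (p := fun n : ℕ => (n : ℝ) + 1)
    (F := fun x : ℝ => (gker x : ℂ)) (s := s) (fun i => Or.inr (by positivity)) (by linarith)
    (by
      intro t ht
      have h1 := exp_neg_lt_one_aux ht
      have h2 := (hasSum_geometric_of_lt_one (Real.exp_pos (-t)).le h1).mul_left (Real.exp (-t))
      have h3 := Complex.hasSum_ofReal.2 h2
      convert h3 using 1
      funext n
      · rw [one_mul, ← Real.exp_nat_mul, ← Real.exp_add]
        congr 2
        ring
      · rw [gker, div_eq_mul_inv])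
    (by simpa using summable_shift hs)
  rw [← h.tsum_eq, zeta_eq_tsum_one_div_nat_add_one_cpow hs, ← tsum_mul_left]
  congr 1
  funext n
  push_cast
  ring

lemma harmonic_cast_bound (n : ℕ) {ε : ℝ} (hε : 0 < ε) :
    ((harmonic (n + 1) : ℚ) : ℝ) ≤ (1 + 1 / ε) * ((n : ℝ) + 1) ^ ε := by
  have h1 := harmonic_le_one_add_log (n + 1)
  have h2 := Real.log_le_rpow_div (x := (n : ℝ) + 1) (by positivity) hε
  have h3 : 1 ≤ ((n : ℝ) + 1) ^ ε := Real.one_le_rpow (by linarith [n.cast_nonneg (α := ℝ)]) hε.le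
  push_cast at h1
  calc _ ≤ _ := h1
    _ ≤ ((n : ℝ) + 1) ^ ε + ((n : ℝ) + 1) ^ ε / ε := add_le_add h3 h2
    _ = _ := by ring

lemma harmonic_cast_nonneg (n : ℕ) : 0 ≤ ((harmonic n : ℚ) : ℝ) := by
  have : 0 ≤ harmonic n := by
    unfold harmonic
    exact Finset.sum_nonneg fun i _ => by positivity
  exact_mod_cast this

lemma summable_harmonic {r : ℝ} (hr : 1 < r) :
    Summable (fun n : ℕ => ((harmonic (n + 1) : ℚ) : ℝ) / ((n : ℝ) + 1) ^ r) := by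
  have hε : 0 < (r - 1) / 2 := by linarith
  refine Summable.of_nonneg_of_le (fun n => div_nonneg (harmonic_cast_nonneg _) (by positivity))
    (fun n => ?_)
    ((summable_shift (r := r - (r - 1) / 2) (by linarith)).mul_left (1 + 1 / ((r - 1) / 2)))
  have hp : 0 < (n : ℝ) + 1 := by positivity
  rw [Real.rpow_sub hp, one_div_div (((n : ℝ) + 1) ^ r), ← mul_div_assoc]
  exact div_le_div_of_nonneg_right (harmonic_cast_bound n hε) (by positivity)

lemma harmonic_le_succ (n : ℕ) : ((harmonic n : ℚ) : ℝ) ≤ ((harmonic (n + 1) : ℚ) : ℝ) := by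
  rw [harmonic_succ]
  push_cast
  have : (0 : ℝ) ≤ ((n : ℝ) + 1)⁻¹ := by positivity
  linarith

lemma harmonic_le_nat (n : ℕ) : ((harmonic n : ℚ) : ℝ) ≤ n := by
  induction n with
  | zero => simp
  | succ n ih =>
    rw [harmonic_succ]
    push_cast
    have : ((n : ℝ) + 1)⁻¹ ≤ 1 := inv_le_one_of_one_le₀ (by linarith [n.cast_nonneg (α := ℝ)])
    linarith

lemma hasSum_harmonic {y : ℝ} (h0 : 0 < y) (h1 : y < 1) :
    HasSum (fun n : ℕ => ((harmonic n : ℚ) : ℝ) * y ^ n) (-Real.log (1 - y) / (1 - y)) := by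
  have hs : Summable (fun n : ℕ => ((harmonic n : ℚ) : ℝ) * y ^ n) := by
    refine Summable.of_nonneg_of_le
      (fun n => mul_nonneg (harmonic_cast_nonneg _) (by positivity)) (fun n => ?_)
      (summable_pow_mul_geometric_of_norm_lt_one 1 (r := y) (by
        rwa [Real.norm_of_nonneg h0.le]))
    rw [pow_one]
    gcongr
    exact harmonic_le_nat n
  obtain ⟨S, hS⟩ := hs
  have hS1 : HasSum (fun n : ℕ => ((harmonic (n + 1) : ℚ) : ℝ) * y ^ (n + 1)) S := by
    rw [hasSum_nat_add_iff (f := fun n : ℕ => ((harmonic n : ℚ) : ℝ) * y ^ n) 1]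
    simpa using hS
  have hS2 := hS1.sub (hS.mul_left y)
  have hL := Real.hasSum_pow_div_log_of_abs_lt_one (x := y) (by rwa [abs_of_pos h0])
  have : S - y * S = -Real.log (1 - y) := by
    refine hS2.unique ?_
    refine hL.congr_fun fun n => ?_
    rw [harmonic_succ]
    push_cast
    have : (n : ℝ) + 1 ≠ 0 := by positivity
    field_simp
    ring
  have : S = -Real.log (1 - y) / (1 - y) := by
    rw [eq_div_iff (by linarith)]
    linarith
  rwa [← this]

lemma gker_log_mellin {s : ℂ} (hs : 1 < s.re) :
    mellin (fun x : ℝ => ((gker x * -Real.log (1 - Real.exp (-x)) : ℝ) : ℂ)) s =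
    Complex.Gamma s *
      ((∑' n : ℕ, ((harmonic (n + 1) : ℚ) : ℂ) * ((n + 1 : ℕ) : ℂ) ^ (-s))
            - riemannZeta (s + 1)) := by
  have hcast : ∀ n : ℕ, ((harmonic n : ℚ) : ℂ) = (((harmonic n : ℚ) : ℝ) : ℂ) := fun n => by simp
  have h := hasSum_mellin (a := fun n : ℕ => ((harmonic n : ℚ) : ℂ))
    (p := fun n : ℕ => (n : ℝ) + 1)
    (F := fun x : ℝ => ((gker x * -Real.log (1 - Real.exp (-x)) : ℝ) : ℂ)) (s := s)
    (fun i => Or.inr (by positivity)) (by linarith)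
    (by
      intro t ht
      have h1 := exp_neg_lt_one_aux ht
      have h2 := (hasSum_harmonic (Real.exp_pos (-t)) h1).mul_left (Real.exp (-t))
      have h3 := Complex.hasSum_ofReal.2 h2
      convert h3 using 1
      · funext n
        rw [hcast, ← Complex.ofReal_mul, ← Real.exp_nat_mul, mul_left_comm, ← Real.exp_add]
        congr 3
        ring
      · rw [gker]
        congr 1
        ring)
    (by
      refine Summable.of_nonneg_of_le (fun n => by positivity) (fun n => ?_) (summable_harmonic hs)
      rw [hcast, Complex.norm_real, Real.norm_of_nonneg (harmonic_cast_nonneg _)]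
      exact div_le_div_of_nonneg_right (harmonic_le_succ n) (by positivity))
  have hne : ∀ n : ℕ, (n : ℂ) + 1 ≠ 0 := fun n => by exact_mod_cast n.succ_ne_zero
  have hsum1 : Summable (fun n : ℕ => ((harmonic (n + 1) : ℚ) : ℂ) * ((n + 1 : ℕ) : ℂ) ^ (-s)) := by
    refine Summable.of_norm ((summable_harmonic hs).congr fun n => ?_)
    rw [norm_mul, hcast, Complex.norm_real, Real.norm_of_nonneg (harmonic_cast_nonneg _),
      Complex.norm_natCast_cpow_of_pos (by omega), Complex.neg_re, Real.rpow_neg (by positivity)]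
    push_cast
    rfl
  have hsum2 : Summable (fun n : ℕ => 1 / ((n : ℂ) + 1) ^ (s + 1)) := by
    refine Summable.of_norm ((summable_shift (r := s.re + 1) (by linarith)).congr fun n => ?_)
    have := Complex.norm_natCast_cpow_of_pos (n := n + 1) (by omega) (s + 1)
    push_cast at this
    rw [norm_div, norm_one, this]
    simp
  rw [← h.tsum_eq, zeta_eq_tsum_one_div_nat_add_one_cpow (by simp; linarith),
    ← hsum1.tsum_sub hsum2, ← tsum_mul_left]
  congr 1
  funext n
  rw [harmonic_succ, Complex.cpow_neg, Complex.cpow_add _ _ (hne n), Complex.cpow_one]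
  push_cast
  have := hne n
  have h2 : ((n : ℂ) + 1) ^ s ≠ 0 := by simp [Complex.cpow_eq_zero_iff, this]
  field_simp
  ring

lemma gker_log_conv {s : ℂ} (hs : 1 < s.re) :
    MellinConvergent (fun x : ℝ => ((gker x * -Real.log (1 - Real.exp (-x)) : ℝ) : ℂ)) s := by
  have hA := (gker_conv (s := s + 1) (by simp; linarith)).norm
  have hB := (gker_deriv hs).1.norm
  refine (hA.add hB).mono' ?_ ?_
  · refine ContinuousOn.aestronglyMeasurable ?_ measurableSet_Ioi
    simp only [smul_eq_mul]
    refine ContinuousOn.mul ?_ ?_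
    · intro x hx
      exact (Complex.continuousAt_ofReal_cpow_const x _ (Or.inr (ne_of_gt hx))).continuousWithinAt
    · refine Complex.continuous_ofReal.comp_continuousOn (gker_cont.mul (ContinuousOn.neg ?_))
      refine ContinuousOn.log (by fun_prop) fun x hx => ?_
      have := exp_neg_lt_one_aux hx
      linarith
  · refine (ae_restrict_mem measurableSet_Ioi).mono fun x hx => ?_
    have hx : 0 < x := hx
    have hg := gker_nonneg hx
    have h1 := exp_neg_lt_one_aux hx
    have hl : Real.log x - x ≤ Real.log (1 - Real.exp (-x)) := by
      have := Real.log_le_log (mul_pos hx (Real.exp_pos (-x))) mul_exp_neg_le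
      rw [Real.log_mul hx.ne' (Real.exp_pos _).ne', Real.log_exp] at this
      linarith
    have hl2 : Real.log (1 - Real.exp (-x)) ≤ 0 :=
      Real.log_nonpos (by linarith) (by linarith [Real.exp_pos (-x)])
    simp only [norm_smul, Pi.add_apply, Complex.norm_real, Complex.norm_cpow_eq_rpow_re_of_pos hx,
      norm_mul, norm_neg]
    rw [show (s + 1 - 1).re = (s - 1).re + 1 by simp, Real.rpow_add hx, Real.rpow_one]
    have hle : ‖Real.log (1 - Real.exp (-x))‖ ≤ x + ‖Real.log x‖ := by
      rw [Real.norm_of_nonpos hl2, Real.norm_eq_abs]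
      linarith [neg_abs_le (Real.log x)]
    calc x ^ (s - 1).re * (‖gker x‖ * ‖Real.log (1 - Real.exp (-x))‖)
        ≤ x ^ (s - 1).re * (‖gker x‖ * (x + ‖Real.log x‖)) := by gcongr
      _ = _ := by ring

/-- For `Re(s) > 1`, the integral `∫_0^∞ x^{s−1} e^{−x}/(1 − e^{−x}) · log((1 − e^{−x})/x) dx`
converges and equals `−Γ(s)·(h(s) − ζ(s+1) + ψ(s)·ζ(s) + ζ′(s))`, where
`h(s) = Σ_{n=1}^∞ H_n n^{−s}` and `ψ(s) = Γ′(s)/Γ(s)`. -/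
theorem integral_F (s : ℂ) (hs : 1 < s.re) :
    IntegrableOn
      (fun x : ℝ => (x : ℂ) ^ (s - 1) * Real.exp (-x) / (1 - Real.exp (-x)) *
        Real.log ((1 - Real.exp (-x)) / x)) (Ioi 0) ∧
    (∫ x : ℝ in Ioi 0, (x : ℂ) ^ (s - 1) * Real.exp (-x) / (1 - Real.exp (-x)) *
        Real.log ((1 - Real.exp (-x)) / x))
      = -Complex.Gamma s *
          ((∑' n : ℕ, ((harmonic (n + 1) : ℚ) : ℂ) * ((n + 1 : ℕ) : ℂ) ^ (-s))
            - riemannZeta (s + 1)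
            + (deriv Complex.Gamma s / Complex.Gamma s) * riemannZeta s
            + deriv riemannZeta s) := by
  have hA := gker_log_conv hs
  have hB := gker_deriv hs
  have hM := hasMellin_add hA hB.1
  have hD : mellin (fun x : ℝ => Real.log x • (gker x : ℂ)) s =
      deriv Complex.Gamma s * riemannZeta s + Complex.Gamma s * deriv riemannZeta s := by
    have hG : HasDerivAt Complex.Gamma (deriv Complex.Gamma s) s := by
      refine (Complex.differentiableAt_Gamma s fun m h => ?_).hasDerivAt
      have := congrArg Complex.re h
      simp at this
      linarith [m.cast_nonneg (α := ℝ)]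
    have hZ : HasDerivAt riemannZeta (deriv riemannZeta s) s := by
      refine (differentiableAt_riemannZeta fun h => ?_).hasDerivAt
      rw [h] at hs
      simp at hs
    refine (hB.2.congr_of_eventuallyEq ?_).unique (hG.mul hZ)
    filter_upwards [(isOpen_lt continuous_const Complex.continuous_re).mem_nhds hs] with z hz
    exact (gker_mellin hz).symm
  have hΓ : Complex.Gamma s ≠ 0 := Complex.Gamma_ne_zero_of_re_pos (by linarith)
  have hEq : EqOn (fun x : ℝ => -((x : ℂ) ^ (s - 1) •
      (((gker x * -Real.log (1 - Real.exp (-x)) : ℝ) : ℂ) + Real.log x • (gker x : ℂ))))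
      (fun x : ℝ => (x : ℂ) ^ (s - 1) * Real.exp (-x) / (1 - Real.exp (-x)) *
        Real.log ((1 - Real.exp (-x)) / x)) (Ioi 0) := by
    intro x hx
    have hx : 0 < x := hx
    have h1 := exp_neg_lt_one_aux hx
    simp only [gker, smul_eq_mul, Complex.real_smul]
    rw [Real.log_div (by linarith) hx.ne']
    push_cast
    ring
  constructor
  · exact (IntegrableOn.congr_fun (Integrable.neg hM.1) hEq measurableSet_Ioi)
  · rw [← setIntegral_congr_fun measurableSet_Ioi hEq, integral_neg]
    have h2 := hM.2
    rw [gker_log_mellin hs, hD] at h2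
    rw [mellin] at h2
    rw [h2]
    field_simp
    ring
end

section
/- There exists a function H : ℂ → ℂ which is analytic on the set U = { s ∈ ℂ : s ≠ 1, s ≠ 0, and s ≠ 1 − 2m for every integer m ≥ 1 }, satisfying H(s) = Σ_{n=1}^∞ H_n n^{−s} for all s with Re(s) > 1, and such that for every integer m ≥ 1, H(−2m) = −B_{2m}/(4m) + B_{2m}/2, where B_{2m} is the Bernoulli number of index 2m. -/
open Complex

/-- The domain of analyticity of the continuation of the Euler sum `h(s) = Σ H_n n^{−s}`:
all `s` except `s = 1`, `s = 0` and the negative odd integers `s = 1 − 2m`, `m ≥ 1`. -/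
def eulerSumDomain : Set ℂ :=
  {s : ℂ | s ≠ 1 ∧ s ≠ 0 ∧ ∀ m : ℕ, 1 ≤ m → s ≠ 1 - 2 * (m : ℂ)}


/-- Bernoulli coefficients of `t/(1-e^{-t})`. -/
noncomputable def betC (n : ℕ) : ℝ := (bernoulli' n : ℝ) / (n.factorial : ℝ)

/-- Coefficients of `-log((1-e^{-t})/t)`. -/
noncomputable def alC (n : ℕ) : ℝ := if n = 1 then 1 / 2 else - betC n / n

lemma betC_bound : ∃ C : ℝ, ∀ n, |betC n| ≤ C * (1 / 4) ^ n := by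
  set Z : ℝ := ∑' n : ℕ, 1 / (n : ℝ) ^ 2 with hZ
  have hZs : Summable (fun n : ℕ => 1 / (n : ℝ) ^ 2) := by
    exact Real.summable_one_div_nat_pow.mpr (by norm_num)
  have hZ0 : 0 ≤ Z := tsum_nonneg (fun n => by positivity)
  refine ⟨2 * Z + 2, fun n => ?_⟩
  rcases Nat.even_or_odd' n with ⟨k, rfl | rfl⟩
  · rcases Nat.eq_zero_or_pos k with rfl | hk
    · simp [betC]; linarith
    · have h := hasSum_zeta_nat hk.ne'
      have hle : ((-1 : ℝ) ^ (k + 1) * (2 : ℝ) ^ (2 * k - 1) * Real.pi ^ (2 * k) *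
        bernoulli (2 * k) / (2 * k).factorial) ≤ Z := by
        refine hasSum_le (fun n => ?_) h hZs.hasSum
        rcases Nat.eq_zero_or_pos n with rfl | hn
        · simp [hk.ne']
        · apply one_div_le_one_div_of_le (by positivity)
          apply pow_le_pow_right₀ (by exact_mod_cast hn) (by omega)
      have h0 : 0 ≤ ((-1 : ℝ) ^ (k + 1) * (2 : ℝ) ^ (2 * k - 1) * Real.pi ^ (2 * k) *
        bernoulli (2 * k) / (2 * k).factorial) := h.nonneg (fun n => by positivity)
      rw [← abs_of_nonneg h0] at hle
      have hb : bernoulli (2 * k) = bernoulli' (2 * k) :=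
        bernoulli_eq_bernoulli'_of_ne_one (by omega)
      rw [hb, mul_div_assoc, abs_mul, abs_mul, abs_mul, abs_pow, abs_neg, abs_one, one_pow, one_mul,
        abs_of_pos (by positivity : (0:ℝ) < 2 ^ (2 * k - 1)),
        abs_of_pos (by positivity : (0:ℝ) < Real.pi ^ (2 * k))] at hle
      change _ * |betC (2 * k)| ≤ Z at hle
      have h2 : (2 : ℝ) ^ (2 * k) = 2 * 2 ^ (2 * k - 1) := by
        rw [← pow_succ']; congr 1; omega
      have h4 : (4 : ℝ) ^ (2 * k) ≤ 2 * (2 ^ (2 * k - 1) * Real.pi ^ (2 * k)) := by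
        rw [← mul_assoc, ← h2, ← mul_pow]
        exact pow_le_pow_left₀ (by norm_num) (by linarith [Real.pi_gt_three]) _
      rw [one_div, inv_pow, ← div_eq_mul_inv, le_div_iff₀ (by positivity)]
      nlinarith [abs_nonneg (betC (2 * k))]
  · rcases Nat.eq_zero_or_pos k with rfl | hk
    · simp [betC]
      linarith
    · have : bernoulli' (2 * k + 1) = 0 := bernoulli'_eq_zero_of_odd ⟨k, rfl⟩ (by omega)
      simp [betC, this]; positivity

lemma betC_summable : Summable (fun n => |betC n| * 2 ^ n) := by
  obtain ⟨C, hC⟩ := betC_bound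
  refine Summable.of_nonneg_of_le (fun n => by positivity) (fun n => ?_)
    ((summable_geometric_of_lt_one (by norm_num) (by norm_num : (1/2:ℝ) < 1)).mul_left C)
  calc |betC n| * 2 ^ n ≤ C * (1 / 4) ^ n * 2 ^ n := by gcongr; exact hC n
    _ = C * (1/2) ^ n := by rw [mul_assoc, ← mul_pow]; norm_num

lemma alC_le (n : ℕ) : |alC n| ≤ |betC n| := by
  unfold alC
  split_ifs with h
  · subst h; simp [betC]
  · rcases Nat.eq_zero_or_pos n with rfl | hn
    · simp
    · rw [abs_div, abs_neg, Nat.abs_cast]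
      exact div_le_self (abs_nonneg _) (by exact_mod_cast hn)

lemma betC_summable' {t : ℝ} (ht : |t| ≤ 2) : Summable (fun n => ‖betC n * t ^ n‖) := by
  refine Summable.of_nonneg_of_le (fun n => by positivity) (fun n => ?_) betC_summable
  rw [norm_mul, norm_pow, Real.norm_eq_abs, Real.norm_eq_abs]; gcongr

lemma alC_summable' {t : ℝ} (ht : |t| ≤ 2) : Summable (fun n => ‖alC n * t ^ n‖) := by
  refine Summable.of_nonneg_of_le (fun n => by positivity) (fun n => ?_) betC_summable
  rw [norm_mul, norm_pow, Real.norm_eq_abs, Real.norm_eq_abs]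
  exact mul_le_mul (alC_le n) (pow_le_pow_left₀ (abs_nonneg _) ht n) (by positivity) (abs_nonneg _)

lemma betC_sum {t : ℝ} (ht0 : 0 < t) (ht : t ≤ 2) :
    ∑' n, betC n * t ^ n = t / (1 - Real.exp (-t)) := by
  have habs : |t| ≤ 2 := by rwa [abs_of_pos ht0]
  have he : HasSum (fun n : ℕ => t ^ n / n.factorial) (Real.exp t) := by
    rw [Real.exp_eq_exp_ℝ]; exact NormedSpace.expSeries_div_hasSum_exp t
  -- coefficients of exp - 1
  have he1 : HasSum (fun n : ℕ => PowerSeries.coeff n (PowerSeries.exp ℝ - 1) * t ^ n)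
      (Real.exp t - 1) := by
    have h1 : HasSum (fun n : ℕ => PowerSeries.coeff n (1 : PowerSeries ℝ) * t ^ n) 1 := by
      have := hasSum_ite_eq (0 : ℕ) (1 : ℝ)
      convert! this using 2 with n
      rw [PowerSeries.coeff_one]; split_ifs with h <;> simp [h]
    convert! he.sub h1 using 2 with n
    rw [map_sub, PowerSeries.coeff_exp, sub_mul]; simp [div_eq_inv_mul]
  have hprod := tsum_mul_tsum_eq_tsum_sum_antidiagonal_of_summable_norm
    (betC_summable' habs) he1.summable.norm
  rw [he1.tsum_eq] at hprod
  have hR : HasSum (fun n : ℕ => PowerSeries.coeff n (PowerSeries.X * PowerSeries.exp ℝ) * t ^ n)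
      (t * Real.exp t) := by
    rw [← hasSum_nat_add_iff' 1]
    simp only [Finset.range_one, Finset.sum_singleton, PowerSeries.coeff_zero_X_mul, zero_mul, sub_zero,
      PowerSeries.coeff_succ_X_mul]
    convert! he.mul_left t using 2 with n
    rw [PowerSeries.coeff_exp]; simp; ring
  have : ∀ n : ℕ, ∑ kl ∈ Finset.HasAntidiagonal.antidiagonal n, betC kl.1 * t ^ kl.1 *
      (PowerSeries.coeff kl.2 (PowerSeries.exp ℝ - 1) * t ^ kl.2) =
      PowerSeries.coeff n (PowerSeries.X * PowerSeries.exp ℝ) * t ^ n := by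
    intro n
    rw [← bernoulli'PowerSeries_mul_exp_sub_one, PowerSeries.coeff_mul, Finset.sum_mul]
    refine Finset.sum_congr rfl fun kl hkl => ?_
    rw [← Finset.HasAntidiagonal.mem_antidiagonal.mp hkl, pow_add]
    have : PowerSeries.coeff kl.1 (bernoulli'PowerSeries ℝ) = betC kl.1 := by
      simp [bernoulli'PowerSeries, betC]
    rw [this]; ring
  simp_rw [this] at hprod
  rw [hR.tsum_eq] at hprod
  have hlt : Real.exp (-t) < 1 := by rw [Real.exp_lt_one_iff]; linarith
  rw [eq_div_iff (by linarith)]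
  have h3 : Real.exp t * Real.exp (-t) = 1 := by rw [← Real.exp_add]; simp
  have h4 : (1 - Real.exp (-t)) = (Real.exp t - 1) * Real.exp (-t) := by linarith
  rw [h4, ← mul_assoc, hprod, mul_assoc, h3, mul_one]

lemma alC_sum {t : ℝ} (ht0 : 0 < t) (ht : t < 2) :
    ∑' n, alC n * t ^ n = Real.log t - Real.log (1 - Real.exp (-t)) := by
  set A : ℝ → ℝ := fun t => ∑' n, alC n * t ^ n with hA
  have hder : ∀ x ∈ Metric.ball (0:ℝ) 2, HasDerivAt A (∑' n, alC n * (n * x ^ (n - 1))) x := by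
    intro x hx
    refine hasDerivAt_tsum_of_isPreconnected (t := Metric.ball (0:ℝ) 2)
      (u := fun n => 2 * (|betC n| * 2 ^ n)) (betC_summable.mul_left 2) Metric.isOpen_ball
      (convex_ball _ _).isPreconnected
      (g := fun n t => alC n * t ^ n) (g' := fun n t => alC n * (n * t ^ (n - 1))) ?_ ?_
      (y₀ := 0) (by simp) ?_ hx
    · intro n y hy
      exact (hasDerivAt_pow n y).const_mul _
    · intro n y hy
      have hy' : |y| ≤ 2 := by simpa using (Metric.mem_ball.mp hy).le
      have hna : |alC n| * n ≤ 2 * |betC n| := by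
        unfold alC
        split_ifs with h
        · subst h; simp [betC]; norm_num [abs_of_pos]
        · rcases Nat.eq_zero_or_pos n with rfl | hn
          · simp
          · rw [abs_div, abs_neg, Nat.abs_cast, div_mul_cancel₀ _ (by positivity)]
            linarith [abs_nonneg (betC n)]
      rw [norm_mul, norm_mul, norm_pow, Real.norm_eq_abs, Real.norm_eq_abs, Real.norm_eq_abs, Nat.abs_cast,
        ← mul_assoc, ← mul_assoc]
      gcongr
      calc |y| ^ (n - 1) ≤ 2 ^ (n - 1) := by gcongr
        _ ≤ 2 ^ n := pow_le_pow_right₀ (by norm_num) (by omega)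
    · exact (alC_summable' (by simp)).of_norm
  have hder2 : ∀ x, 0 < x → x < 2 → HasDerivAt A (1 / x - 1 / (1 - Real.exp (-x)) + 1) x := by
    intro x hx0 hx
    have h := hder x (by simp [abs_of_pos hx0, hx])
    convert! h using 1
    have hb := (betC_summable' (t := x) (by rw [abs_of_pos hx0]; exact hx.le)).of_norm
    have hs := hb.hasSum
    rw [betC_sum hx0 hx.le] at hs
    have h0 := hasSum_ite_eq (0 : ℕ) (1 / x)
    have h1 := hasSum_ite_eq (1 : ℕ) (1 : ℝ)
    have := ((hs.mul_right (-1 / x)).add h0).add h1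
    have h2 : HasSum (fun n : ℕ => alC n * (n * x ^ (n - 1)))
        (x / (1 - Real.exp (-x)) * (-1 / x) + 1 / x + 1) := by
      convert! this using 2 with n
      rcases n with _ | n
      · simp [betC]; ring
      · rcases n with _ | n
        · simp [alC, betC]; field_simp; norm_num
        · simp [alC]; field_simp; ring
    rw [h2.tsum_eq]; field_simp; ring
  have hpos : ∀ x : ℝ, 0 < x → 0 < 1 - Real.exp (-x) := by
    intro x hx
    have : Real.exp (-x) < 1 := by rw [Real.exp_lt_one_iff]; linarith
    linarith
  set φ : ℝ → ℝ := fun t => A t - (Real.log t - Real.log (1 - Real.exp (-t))) with hφ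
  have hφd : ∀ x ∈ Set.Ioo (0:ℝ) 2, HasDerivAt φ 0 x := by
    intro x ⟨hx0, hx⟩
    have h1 : HasDerivAt (fun t : ℝ => 1 - Real.exp (-t)) (Real.exp (-x)) x := by
      have := ((hasDerivAt_neg x).exp).const_sub 1
      simpa using this
    have := (hder2 x hx0 hx).sub ((Real.hasDerivAt_log hx0.ne').sub (h1.log (hpos x hx0).ne'))
    convert! this using 1
    have h5 := (hpos x hx0).ne'
    field_simp; ring
  have hconst : ∀ x ∈ Set.Ioo (0:ℝ) 2, φ x = φ t := by
    intro x hx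
    exact isOpen_Ioo.is_const_of_deriv_eq_zero (isPreconnected_Ioo)
      (fun y hy => (hφd y hy).differentiableAt.differentiableWithinAt)
      (fun y hy => (hφd y hy).deriv) hx ⟨ht0, ht⟩
  have hlim : Filter.Tendsto φ (nhdsWithin 0 (Set.Ioi 0)) (nhds 0) := by
    have hA0 : Filter.Tendsto A (nhdsWithin 0 (Set.Ioi 0)) (nhds 0) := by
      have : A 0 = 0 := by
        rw [hA]; simp only
        rw [tsum_eq_single 0]
        · simp [alC]
        · intro n hn; simp [hn]
      have h2 := (hder 0 (by simp)).continuousAt.tendsto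
      rw [this] at h2
      exact h2.mono_left nhdsWithin_le_nhds
    have hl : Filter.Tendsto (fun x : ℝ => Real.log ((1 - Real.exp (-x)) / x))
        (nhdsWithin 0 (Set.Ioi 0)) (nhds 0) := by
      have h1 : HasDerivAt (fun t : ℝ => 1 - Real.exp (-t)) (Real.exp (-0)) 0 := by
        have := ((hasDerivAt_neg (0:ℝ)).exp).const_sub 1
        simpa using this
      have h2 := h1.tendsto_slope_zero_right
      simp only [zero_add, neg_zero, Real.exp_zero, sub_self, sub_zero, smul_eq_mul] at h2
      have h3 := (Real.continuousAt_log one_ne_zero).tendsto.comp h2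
      rw [Real.log_one] at h3
      refine h3.congr fun x => ?_
      simp [div_eq_inv_mul]
    have := hA0.add hl
    rw [add_zero] at this
    refine this.congr' ?_
    filter_upwards [self_mem_nhdsWithin] with x hx
    have hx : 0 < x := hx
    rw [Real.log_div (hpos x hx).ne' hx.ne']
    simp only [hφ]; ring
  have hlim2 : Filter.Tendsto φ (nhdsWithin 0 (Set.Ioi 0)) (nhds (φ t)) := by
    refine tendsto_const_nhds.congr' ?_
    filter_upwards [Ioo_mem_nhdsGT (show (0:ℝ) < 2 by norm_num)] with x hx
    exact (hconst x hx).symm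
  have := tendsto_nhds_unique hlim hlim2
  simp only [hφ] at this
  change A t = _
  linarith


/-- Mellin transform over `(0,1]` of `∑ c_n t^{n-1}`. -/
noncomputable def PM (c : ℕ → ℂ) (s : ℂ) : ℂ := ∑' n : ℕ, c n / (s + n - 1)

lemma exists_delta (s : ℂ) : ∃ δ > 0, ∀ n : ℕ, s + n - 1 ≠ 0 → δ ≤ ‖s + n - 1‖ := by
  have h : Filter.Tendsto (fun n : ℕ => ‖s + n - 1‖⁻¹) Filter.atTop (nhds 0) := by
    apply Filter.Tendsto.inv_tendsto_atTop
    have h1 : Filter.Tendsto (fun n : ℕ => (n : ℝ) - ‖s - 1‖) Filter.atTop Filter.atTop :=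
      Filter.tendsto_atTop_add_const_right _ _ tendsto_natCast_atTop_atTop
    refine Filter.tendsto_atTop_mono (fun n => ?_) h1
    have : (n : ℂ) = (s + n - 1) - (s - 1) := by ring
    have h2 : ‖(n : ℂ)‖ ≤ ‖s + n - 1‖ + ‖s - 1‖ := by
      conv_lhs => rw [this]
      exact norm_sub_le _ _
    rw [Complex.norm_natCast] at h2
    linarith
  obtain ⟨C, hC⟩ := h.bddAbove_range
  refine ⟨(max C 1)⁻¹, by positivity, fun n hn => ?_⟩
  have h1 : ‖s + n - 1‖⁻¹ ≤ C := hC ⟨n, rfl⟩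
  have h2 : 0 < ‖s + n - 1‖ := norm_pos_iff.mpr hn
  rw [inv_le_comm₀ (by positivity) h2]
  exact h1.trans (le_max_left _ _)

lemma PM_analyticAt {c : ℕ → ℂ} (hc : Summable (fun n => ‖c n‖)) {s : ℂ}
    (hs : ∀ n : ℕ, c n = 0 ∨ s + n - 1 ≠ 0) : AnalyticAt ℂ (PM c) s := by
  obtain ⟨δ, hδ, h⟩ := exists_delta s
  have hb : ∀ n : ℕ, ∀ w ∈ Metric.ball s (δ / 2), c n = 0 ∨ δ / 2 ≤ ‖w + n - 1‖ := by
    intro n w hw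
    rcases hs n with h0 | h0
    · exact Or.inl h0
    · right
      have h1 := h n h0
      have h2 : ‖s - w‖ < δ / 2 := by rw [← dist_eq_norm, dist_comm]; exact hw
      have h3 : ‖s + n - 1‖ ≤ ‖s - w‖ + ‖w + n - 1‖ := by
        refine le_trans (le_of_eq ?_) (norm_add_le _ _); congr 1; ring
      linarith
  have hd : DifferentiableOn ℂ (PM c) (Metric.ball s (δ / 2)) := by
    refine Complex.differentiableOn_tsum_of_summable_norm (u := fun n => ‖c n‖ / (δ / 2))
      (hc.div_const _) ?_ Metric.isOpen_ball ?_
    · intro n w hw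
      rcases hb n w hw with h0 | h0
      · simp only [h0, zero_div]; exact differentiableWithinAt_const _
      · apply DifferentiableAt.differentiableWithinAt
        have : w + n - 1 ≠ 0 := by
          rw [← norm_pos_iff]; linarith
        fun_prop (disch := assumption)
    · intro n w hw
      rcases hb n w hw with h0 | h0
      · simp [h0]
      · rw [norm_div]; gcongr
  exact hd.analyticAt (Metric.isOpen_ball.mem_nhds (Metric.mem_ball_self (by positivity)))

open Set MeasureTheory Filter Topology Asymptotics in
lemma mellin_ps {c : ℕ → ℂ} (hc : Summable (fun n => ‖c n‖)) {s : ℂ} (hs : 1 < s.re) :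
    HasMellin (indicator (Ioc (0:ℝ) 1) (fun t => (∑' n, c n * (t:ℂ) ^ n) / t)) s (PM c s) ∧
    HasMellin (fun t => Real.log t • indicator (Ioc (0:ℝ) 1)
      (fun t => (∑' n, c n * (t:ℂ) ^ n) / t) t) s (deriv (PM c) s) := by
  set f := indicator (Ioc (0:ℝ) 1) (fun t : ℝ => (∑' n, c n * (t:ℂ) ^ n) / t) with hf
  have hg : ContinuousOn (fun t : ℝ => ∑' n, c n * (t:ℂ) ^ n) (Icc 0 1) := by
    refine continuousOn_tsum (fun n => by fun_prop) hc (fun n t ht => ?_)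
    rw [norm_mul, norm_pow, Complex.norm_real, Real.norm_of_nonneg ht.1]
    exact mul_le_of_le_one_right (norm_nonneg _) (pow_le_one₀ ht.1 ht.2)
  have hbound : ∀ t ∈ Icc (0:ℝ) 1, ‖∑' n, c n * (t:ℂ) ^ n‖ ≤ ∑' n, ‖c n‖ := by
    intro t ht
    refine tsum_of_norm_bounded hc.hasSum fun n => ?_
    rw [norm_mul, norm_pow, Complex.norm_real, Real.norm_of_nonneg ht.1]
    exact mul_le_of_le_one_right (norm_nonneg _) (pow_le_one₀ ht.1 ht.2)
  have hcont : ContinuousOn (fun t : ℝ => (∑' n, c n * (t:ℂ) ^ n) / t) (Ioc 0 1) := by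
    refine (hg.mono Ioc_subset_Icc_self).div (by fun_prop) fun t ht => ?_
    exact_mod_cast ht.1.ne'
  have hloc : LocallyIntegrableOn f (Ioi 0) := by
    rw [locallyIntegrableOn_iff (by exact isLocallyClosed_Ioi)]
    intro K hK hKc
    rw [hf, IntegrableOn, integrable_indicator_iff measurableSet_Ioc, IntegrableOn,
      Measure.restrict_restrict measurableSet_Ioc]
    have : Ioc (0:ℝ) 1 ∩ K = Icc 0 1 ∩ K := by
      ext x; constructor
      · rintro ⟨h1, h2⟩; exact ⟨⟨h1.1.le, h1.2⟩, h2⟩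
      · rintro ⟨h1, h2⟩; exact ⟨⟨hK h2, h1.2⟩, h2⟩
    refine ContinuousOn.integrableOn_compact ?_ (hcont.mono inter_subset_left)
    rw [this]
    exact hKc.inter_left isClosed_Icc
  have htop : ∀ a : ℝ, f =O[atTop] (· ^ (-a)) := by
    intro a
    refine IsBigO.of_bound 1 ?_
    filter_upwards [eventually_gt_atTop 1] with t ht
    rw [hf, indicator_of_notMem (by simp [ht])]
    simp
  have hbot : f =O[𝓝[>] 0] (· ^ (-(1:ℝ))) := by
    refine IsBigO.of_bound (∑' n, ‖c n‖) ?_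
    filter_upwards [Ioc_mem_nhdsGT (show (0:ℝ) < 1 by norm_num)] with t ht
    rw [hf, indicator_of_mem ht, Real.rpow_neg_one, norm_div, Complex.norm_real, norm_inv,
      div_eq_mul_inv]
    gcongr
    exact hbound t ⟨ht.1.le, ht.2⟩
  have hval : ∀ z : ℂ, 1 < z.re → mellin f z = PM c z := by
    intro z hz
    have hre : ∀ n : ℕ, 0 < z.re + ((n : ℂ) - 1).re := by
      intro n; simp; have : (0:ℝ) ≤ n := n.cast_nonneg
      linarith
    have hre' : ∀ n : ℕ, 0 < (z.re : ℂ).re + ((n : ℂ) - 1).re := by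
      intro n; simpa using hre n
    have key : HasSum (fun n => ∫ t in Ioi (0:ℝ), (t:ℂ) ^ (z - 1) •
        (c n * indicator (Ioc (0:ℝ) 1) (fun t => (t:ℂ) ^ ((n:ℂ) - 1)) t))
        (∫ t in Ioi (0:ℝ), ∑' n, (t:ℂ) ^ (z - 1) •
        (c n * indicator (Ioc (0:ℝ) 1) (fun t => (t:ℂ) ^ ((n:ℂ) - 1)) t)) := by
      refine hasSum_integral_of_summable_integral_norm (fun n => ?_) ?_
      · have := (hasMellin_cpow_Ioc ((n:ℂ) - 1) (hre n)).1.const_smul (c n)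
        exact this
      · refine Summable.of_nonneg_of_le (fun n => integral_nonneg fun t => norm_nonneg _) (fun n => ?_)
          (hc.mul_right (1 / (z.re - 1)))
        have h1 := (hasMellin_cpow_Ioc ((n:ℂ) - 1) (hre' n)).2
        have h2 : ∫ t in Ioi (0:ℝ), ‖(t:ℂ) ^ (z - 1) •
          (c n * indicator (Ioc (0:ℝ) 1) (fun t => (t:ℂ) ^ ((n:ℂ) - 1)) t)‖ =
          ‖c n‖ * (1 / (z.re + (n - 1))) := by
          have h3 : ((∫ t in Ioi (0:ℝ), ‖(t:ℂ) ^ (z - 1) •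
            (c n * indicator (Ioc (0:ℝ) 1) (fun t => (t:ℂ) ^ ((n:ℂ) - 1)) t)‖ : ℝ) : ℂ) =
            ‖c n‖ * (1 / (z.re + (n - 1))) := by
            rw [← h1, mellin, ← integral_complex_ofReal, ← integral_const_mul]
            refine setIntegral_congr_fun measurableSet_Ioi fun t ht => ?_
            have ht : 0 < t := ht
            simp only [smul_eq_mul, norm_mul]
            by_cases hm : t ∈ Ioc (0:ℝ) 1
            · rw [indicator_of_mem hm,
                Complex.norm_cpow_eq_rpow_re_of_pos ht, Complex.norm_cpow_eq_rpow_re_of_pos ht]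
              have e1 : (z.re : ℂ) - 1 = ((z.re - 1 : ℝ) : ℂ) := by push_cast; rfl
              have e2 : (n : ℂ) - 1 = ((n - 1 : ℝ) : ℂ) := by push_cast; rfl
              rw [e1, e2, ← Complex.ofReal_cpow ht.le, ← Complex.ofReal_cpow ht.le, Complex.ofReal_re]
              push_cast [Complex.sub_re, Complex.one_re]
              ring
            · rw [indicator_of_notMem hm]; simp
          exact_mod_cast h3
        rw [h2]
        have : (0:ℝ) ≤ n := n.cast_nonneg
        gcongr
        linarith
    have hR : (∫ t in Ioi (0:ℝ), ∑' n, (t:ℂ) ^ (z - 1) •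
        (c n * indicator (Ioc (0:ℝ) 1) (fun t => (t:ℂ) ^ ((n:ℂ) - 1)) t)) = mellin f z := by
      rw [mellin]
      refine setIntegral_congr_fun measurableSet_Ioi fun t ht => ?_
      have ht : 0 < t := ht
      have ht' : (t:ℂ) ≠ 0 := by exact_mod_cast ht.ne'
      simp only [smul_eq_mul]
      rw [tsum_mul_left]
      congr 1
      by_cases hm : t ∈ Ioc (0:ℝ) 1
      · rw [hf, indicator_of_mem hm, ← tsum_div_const]
        refine tsum_congr fun n => ?_
        rw [indicator_of_mem hm, Complex.cpow_sub _ _ ht', Complex.cpow_one, Complex.cpow_natCast]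
        ring
      · rw [hf, indicator_of_notMem hm]
        simp [indicator_of_notMem hm]
    rw [← hR, ← key.tsum_eq, PM]
    refine tsum_congr fun n => ?_
    have h1 := (hasMellin_const_smul (hasMellin_cpow_Ioc ((n:ℂ) - 1) (hre n)).1 (c n)).2
    rw [(hasMellin_cpow_Ioc ((n:ℂ) - 1) (hre n)).2] at h1
    rw [mellin] at h1
    simp only [smul_eq_mul] at h1 ⊢
    rw [h1, add_sub_assoc]; ring
  obtain ⟨hm1, hm2⟩ := mellin_hasDerivAt_of_isBigO_rpow hloc (htop (s.re + 1)) (lt_add_one _) hbot hs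
  refine ⟨⟨mellinConvergent_of_isBigO_rpow hloc (htop (s.re + 1)) (lt_add_one _) hbot hs, hval s hs⟩,
    hm1, ?_⟩
  rw [← hm2.deriv]
  apply Filter.EventuallyEq.deriv_eq
  filter_upwards [(isOpen_lt continuous_const Complex.continuous_re).mem_nhds hs] with z hz
  exact hval z hz

/-- The generating function `∑ H_n e^{-nt}`. -/
noncomputable def FT (t : ℝ) : ℂ :=
  ((-Real.log (1 - Real.exp (-t)) / (1 - Real.exp (-t)) : ℝ) : ℂ)

lemma one_sub_exp_pos {x : ℝ} (hx : 0 < x) : 0 < 1 - Real.exp (-x) := by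
  have : Real.exp (-x) < 1 := by rw [Real.exp_lt_one_iff]; linarith
  linarith

lemma FT_hasSum {t : ℝ} (ht : 0 < t) :
    HasSum (fun n : ℕ => ((harmonic (n + 1) : ℚ) : ℂ) * Real.exp (-((n + 1 : ℕ) : ℝ) * t)) (FT t) := by
  set x := Real.exp (-t) with hx
  have hx0 : 0 < x := Real.exp_pos _
  have hx1 : x < 1 := by have := one_sub_exp_pos ht; linarith
  have h1 := Real.hasSum_pow_div_log_of_abs_lt_one (x := x) (by rwa [abs_of_pos hx0])
  have h2 := hasSum_geometric_of_lt_one hx0.le hx1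
  have h3 := hasSum_sum_range_mul_of_summable_norm h1.summable.norm h2.summable.norm
  rw [h1.tsum_eq, h2.tsum_eq] at h3
  have h4 := Complex.hasSum_ofReal.mpr h3
  convert! h4 using 1
  ext n
  have h5 : Real.exp (-((n + 1 : ℕ) : ℝ) * t) = x ^ (n + 1) := by
    rw [hx, ← Real.exp_nat_mul]; congr 1; ring
  rw [h5]
  have h6 : (((harmonic (n + 1) : ℚ) : ℝ) : ℂ) = ((harmonic (n + 1) : ℚ) : ℂ) := by push_cast; rfl
  rw [← h6, ← Complex.ofReal_mul]
  congr 1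
  rw [harmonic, Rat.cast_sum, Finset.sum_mul]
  refine Finset.sum_congr rfl fun k hk => ?_
  have hk' : k ≤ n := by simpa [Nat.lt_succ_iff] using hk
  have : n + 1 = (k + 1) + (n - k) := by omega
  rw [this, pow_add]
  push_cast
  ring

lemma harmonic_summable {σ : ℝ} (hσ : 1 < σ) :
    Summable (fun n : ℕ => ‖((harmonic (n + 1) : ℚ) : ℂ)‖ / ((n + 1 : ℕ) : ℝ) ^ σ) := by
  set ε := (σ - 1) / 2 with hε
  have hε0 : 0 < ε := by rw [hε]; linarith
  have hs : Summable (fun n : ℕ => (1 + 1 / ε) * (1 / ((n + 1 : ℕ) : ℝ) ^ (σ - ε))) := by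
    apply Summable.mul_left
    have := Real.summable_one_div_nat_rpow (p := σ - ε) |>.mpr (by rw [hε]; linarith)
    exact (summable_nat_add_iff 1).mpr this
  refine Summable.of_nonneg_of_le (fun n => by positivity) (fun n => ?_) hs
  have hpos : (0:ℝ) < ((n + 1 : ℕ) : ℝ) := by positivity
  have hone : (1:ℝ) ≤ ((n + 1 : ℕ) : ℝ) := by exact_mod_cast Nat.le_add_left 1 n
  have hnn : ‖((harmonic (n + 1) : ℚ) : ℂ)‖ = ((harmonic (n + 1) : ℚ) : ℝ) := by
    have h6 : (((harmonic (n + 1) : ℚ) : ℝ) : ℂ) = ((harmonic (n + 1) : ℚ) : ℂ) := by push_cast; rfl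
    rw [← h6, Complex.norm_real, Real.norm_of_nonneg]
    exact_mod_cast (harmonic_pos (by omega)).le
  clear_value ε
  rw [hnn, Real.rpow_sub hpos, one_div_div (_ ^ σ), ← mul_div_assoc]
  rw [div_le_div_iff_of_pos_right (by positivity)]
  have h1 := harmonic_le_one_add_log (n + 1)
  have h2 := Real.log_le_rpow_div hpos.le hε0
  have h3 : (1:ℝ) ≤ ((n + 1 : ℕ) : ℝ) ^ ε := Real.one_le_rpow hone hε0.le
  calc ((harmonic (n + 1) : ℚ) : ℝ) ≤ 1 + ((n + 1 : ℕ) : ℝ) ^ ε / ε := by linarith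
    _ ≤ ((n + 1 : ℕ) : ℝ) ^ ε + ((n + 1 : ℕ) : ℝ) ^ ε / ε := by linarith
    _ = _ := by ring

lemma FT_mellin {s : ℂ} (hs : 1 < s.re) :
    mellin FT s = Complex.Gamma s *
      ∑' n : ℕ, ((harmonic (n + 1) : ℚ) : ℂ) * ((n + 1 : ℕ) : ℂ) ^ (-s) := by
  have h := hasSum_mellin (a := fun n : ℕ => ((harmonic (n + 1) : ℚ) : ℂ))
    (p := fun n => ((n + 1 : ℕ) : ℝ)) (F := FT) (s := s)
    (fun n => Or.inr (by positivity)) (by linarith) (fun t ht => FT_hasSum ht) (harmonic_summable hs)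
  rw [← h.tsum_eq, ← tsum_mul_left]
  refine tsum_congr fun n => ?_
  rw [Complex.cpow_neg, Complex.ofReal_natCast]; ring

open Set MeasureTheory Filter Topology Asymptotics in
lemma tail_convergent (s : ℂ) : MellinConvergent (indicator (Ioi (1:ℝ)) FT) s ∧
    DifferentiableAt ℂ (mellin (indicator (Ioi (1:ℝ)) FT)) s := by
  have hcont : ContinuousOn FT (Ioi 0) := by
    apply Complex.continuous_ofReal.comp_continuousOn
    have h1 : ContinuousOn (fun t : ℝ => 1 - Real.exp (-t)) (Ioi 0) := by fun_prop
    exact (h1.log fun t ht => (one_sub_exp_pos ht).ne').neg.div h1 fun t ht => (one_sub_exp_pos ht).ne'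
  have hloc : LocallyIntegrableOn (indicator (Ioi (1:ℝ)) FT) (Ioi 0) := by
    rw [locallyIntegrableOn_iff (by exact isLocallyClosed_Ioi)]
    intro K hK hKc
    exact ((hcont.mono hK).integrableOn_compact hKc).indicator measurableSet_Ioi
  have htop : indicator (Ioi (1:ℝ)) FT =O[atTop] fun t => Real.exp (-1 * t) := by
    refine IsBigO.of_bound 4 ?_
    filter_upwards [eventually_gt_atTop 1] with t ht
    rw [indicator_of_mem (show t ∈ Ioi (1:ℝ) from ht), FT, Complex.norm_real, neg_one_mul]
    have hx0 : 0 < Real.exp (-t) := Real.exp_pos _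
    have hx1 : Real.exp (-t) ≤ 1 / 2 := by
      have h1 : 2 ≤ Real.exp t := by
        have := Real.add_one_le_exp t; linarith
      rw [Real.exp_neg, one_div]; exact inv_anti₀ (by norm_num) h1
    set x := Real.exp (-t)
    have h1 : (1 - x)⁻¹ ≤ 2 := by
      rw [inv_le_comm₀ (by linarith) (by norm_num)]; linarith
    have h2 := Real.one_sub_inv_le_log_of_pos (show 0 < 1 - x by linarith)
    have h3 := Real.log_nonpos (show 0 ≤ 1 - x by linarith) (by linarith)
    have h4 : (1 - x) * (1 - x)⁻¹ = 1 := mul_inv_cancel₀ (by linarith)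
    rw [Real.norm_of_nonneg (div_nonneg (by linarith) (by linarith)), Real.norm_of_nonneg hx0.le,
      div_eq_mul_inv]
    have h5 : -Real.log (1 - x) ≤ 2 * x := by nlinarith
    have h6 : 0 ≤ (1 - x)⁻¹ := by rw [inv_nonneg]; linarith
    calc _ ≤ (2 * x) * 2 := by gcongr
      _ = _ := by ring
  have hbot : indicator (Ioi (1:ℝ)) FT =O[𝓝[>] 0] (· ^ (-(s.re - 1))) := by
    refine IsBigO.of_bound 1 ?_
    filter_upwards [Ioc_mem_nhdsGT (show (0:ℝ) < 1 by norm_num)] with t ht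
    rw [indicator_of_notMem (by simpa using ht.2)]
    simp
  exact ⟨mellinConvergent_of_isBigO_rpow_exp one_pos hloc htop hbot (by linarith),
    mellin_differentiableAt_of_isBigO_rpow_exp one_pos hloc htop hbot (by linarith)⟩

noncomputable def kapR (n : ℕ) : ℝ :=
  ∑ kl ∈ Finset.HasAntidiagonal.antidiagonal n, betC kl.1 * alC kl.2

lemma kapR_summable : Summable (fun n => ‖((kapR n : ℝ) : ℂ)‖) := by
  have h1 := betC_summable' (t := 1) (by norm_num)
  have h2 := alC_summable' (t := 1) (by norm_num)
  simp only [one_pow, mul_one] at h1 h2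
  simpa only [Complex.norm_real] using! summable_norm_sum_mul_antidiagonal_of_summable_norm h1 h2

lemma betC_summableC : Summable (fun n => ‖((betC n : ℝ) : ℂ)‖) := by
  have h1 := betC_summable' (t := 1) (by norm_num)
  simp only [one_pow, mul_one] at h1
  simpa only [Complex.norm_real] using! h1

lemma kapR_sum {t : ℝ} (ht0 : 0 < t) (ht : t < 2) : ∑' n, kapR n * t ^ n =
    (t / (1 - Real.exp (-t))) * (Real.log t - Real.log (1 - Real.exp (-t))) := by
  have habs : |t| ≤ 2 := by rw [abs_of_pos ht0]; exact ht.le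
  rw [← betC_sum ht0 ht.le, ← alC_sum ht0 ht,
    tsum_mul_tsum_eq_tsum_sum_antidiagonal_of_summable_norm (betC_summable' habs) (alC_summable' habs)]
  refine tsum_congr fun n => ?_
  rw [kapR, Finset.sum_mul]
  refine Finset.sum_congr rfl fun kl hkl => ?_
  rw [← Finset.HasAntidiagonal.mem_antidiagonal.mp hkl, pow_add]; ring

/-- The raw continuation formula. -/
noncomputable def rawH (s : ℂ) : ℂ :=
  (Complex.Gamma s)⁻¹ * (mellin (Set.indicator (Set.Ioi (1:ℝ)) FT) s
    - deriv (PM fun n => (betC n : ℂ)) s + PM (fun n => (kapR n : ℂ)) s)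

open Set MeasureTheory in
lemma rawH_eq {s : ℂ} (hs : 1 < s.re) :
    rawH s = ∑' n : ℕ, ((harmonic (n + 1) : ℚ) : ℂ) * ((n + 1 : ℕ) : ℂ) ^ (-s) := by
  have h1 := (mellin_ps betC_summableC hs).2
  have h2 := (mellin_ps kapR_summable hs).1
  have h3 := hasMellin_sub (tail_convergent s).1 h1.1
  have h4 := hasMellin_add h3.1 h2.1
  have h5 : mellin FT s = mellin (Set.indicator (Set.Ioi (1:ℝ)) FT) s
    - deriv (PM fun n => (betC n : ℂ)) s + PM (fun n => (kapR n : ℂ)) s := by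
    rw [← h1.2, ← h2.2, ← h3.2, ← h4.2]
    refine setIntegral_congr_fun measurableSet_Ioi fun t ht => ?_
    have ht : 0 < t := ht
    simp only
    congr 1
    by_cases h : t ≤ 1
    · have hm : t ∈ Ioc (0:ℝ) 1 := ⟨ht, h⟩
      rw [indicator_of_notMem (show t ∉ Ioi (1:ℝ) by simpa using h), indicator_of_mem hm,
        indicator_of_mem hm]
      have e1 : ∑' n, ((betC n : ℝ) : ℂ) * (t:ℂ) ^ n = ((∑' n, betC n * t ^ n : ℝ) : ℂ) := by
        push_cast; rfl
      have e2 : ∑' n, ((kapR n : ℝ) : ℂ) * (t:ℂ) ^ n = ((∑' n, kapR n * t ^ n : ℝ) : ℂ) := by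
        push_cast; rfl
      rw [e1, e2, betC_sum ht (by linarith), kapR_sum ht (by linarith), FT, Complex.real_smul]
      norm_cast
      have := (one_sub_exp_pos ht).ne'
      have ht' := ht.ne'
      generalize Real.log (1 - Real.exp (-t)) = L
      generalize Real.log t = M
      generalize 1 - Real.exp (-t) = D at *
      field_simp
      ring
    · have hm : t ∉ Ioc (0:ℝ) 1 := fun h' => h h'.2
      rw [indicator_of_mem (show t ∈ Ioi (1:ℝ) by simpa using h), indicator_of_notMem hm,
        indicator_of_notMem hm]
      simp
  rw [rawH, ← h5, FT_mellin hs, ← mul_assoc, inv_mul_cancel₀, one_mul]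
  exact Complex.Gamma_ne_zero_of_re_pos (by linarith)

lemma betC_odd {n : ℕ} (h : Odd n) (hn : 1 < n) : betC n = 0 := by
  simp [betC, bernoulli'_eq_zero_of_odd h hn]

lemma alC_odd {n : ℕ} (h : Odd n) (hn : 1 < n) : alC n = 0 := by
  rw [alC, if_neg (by omega), betC_odd h hn]; simp

lemma kapR_odd {m : ℕ} (hm : 1 ≤ m) :
    kapR (2 * m + 1) * (2 * m).factorial =
      -(bernoulli (2 * m) : ℝ) / (4 * m) + (bernoulli (2 * m) : ℝ) / 2 := by
  have h : kapR (2 * m + 1) = ∑ kl ∈ ({(1, 2 * m), (2 * m, 1)} : Finset (ℕ × ℕ)),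
      betC kl.1 * alC kl.2 := by
    rw [kapR]
    symm
    apply Finset.sum_subset
    · intro x hx
      simp only [Finset.mem_insert, Finset.mem_singleton] at hx
      rw [Finset.HasAntidiagonal.mem_antidiagonal]
      rcases hx with rfl | rfl
      · simp; omega
      · simp
    · rintro ⟨i, j⟩ hx hx'
      rw [Finset.HasAntidiagonal.mem_antidiagonal] at hx
      simp only [Finset.mem_insert, Finset.mem_singleton, Prod.mk.injEq, not_or, not_and] at hx hx' ⊢
      rcases Nat.even_or_odd i with hi | hi
      · have hj : Odd j := by
          rcases Nat.even_or_odd j with hj | hj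
          · exfalso; obtain ⟨a, ha⟩ := hi; obtain ⟨b, hb⟩ := hj; omega
          · exact hj
        have : j ≠ 1 := fun h => hx'.2 (by omega) h
        rw [alC_odd hj (by obtain ⟨b, hb⟩ := hj; omega), mul_zero]
      · have : i ≠ 1 := fun h => hx'.1 h (by omega)
        rw [betC_odd hi (by obtain ⟨b, hb⟩ := hi; omega), zero_mul]
  have hf : ((2 * m).factorial : ℝ) ≠ 0 := by positivity
  have hm' : (m : ℝ) ≠ 0 := by positivity
  have hb1 : betC 1 = 1 / 2 := by simp [betC]
  have ha1 : alC 1 = 1 / 2 := by simp [alC]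
  rw [h, Finset.sum_pair (by intro hh; have := (Prod.mk.inj hh).1; omega), hb1, ha1, alC, if_neg (by omega),
    bernoulli_eq_bernoulli'_of_ne_one (by omega), betC]
  push_cast
  field_simp
  ring

lemma inv_Gamma_prod (s : ℂ) (N : ℕ) :
    (Complex.Gamma s)⁻¹ = (∏ j ∈ Finset.range N, (s + j)) * (Complex.Gamma (s + N))⁻¹ := by
  induction N with
  | zero => simp
  | succ N ih =>
    rw [ih, Finset.prod_range_succ, Complex.one_div_Gamma_eq_self_mul_one_div_Gamma_add_one (s + N)]
    push_cast
    rw [mul_assoc, add_assoc]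

/-- The continuation, with removable singularities removed. -/
noncomputable def contH (s : ℂ) : ℂ := Filter.limUnder (nhdsWithin s {s}ᶜ) rawH

open Filter Topology in
lemma contH_eventuallyEq {s₀ : ℂ} {g : ℂ → ℂ} (hg : AnalyticAt ℂ g s₀)
    (h : ∀ᶠ s in 𝓝[≠] s₀, rawH s = g s) : contH =ᶠ[𝓝 s₀] g := by
  rw [eventually_nhdsWithin_iff] at h
  have h1 := hg.eventually_analyticAt
  filter_upwards [h.eventually_nhds, h1, h] with s h2 h3 h4
  apply Tendsto.limUnder_eq
  have h5 : Tendsto g (𝓝[≠] s) (𝓝 (g s)) := h3.continuousAt.tendsto.mono_left nhdsWithin_le_nhds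
  refine h5.congr' ?_
  by_cases hs : s = s₀
  · subst hs
    rw [EventuallyEq, eventually_nhdsWithin_iff]
    filter_upwards [h2] with w hw hw'
    exact (hw hw').symm
  · filter_upwards [nhdsWithin_le_nhds h2, nhdsWithin_le_nhds (isOpen_ne.mem_nhds hs)] with w hw hw'
    exact (hw hw').symm

lemma tail_analyticAt (s : ℂ) :
    AnalyticAt ℂ (mellin (Set.indicator (Set.Ioi (1:ℝ)) FT)) s :=
  Complex.analyticAt_iff_eventually_differentiableAt.mpr
    (Filter.Eventually.of_forall fun z => (tail_convergent z).2)

lemma invGamma_analyticAt (s : ℂ) : AnalyticAt ℂ (fun s => (Complex.Gamma s)⁻¹) s :=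
  Complex.analyticAt_iff_eventually_differentiableAt.mpr
    (Filter.Eventually.of_forall fun z => Complex.differentiable_one_div_Gamma z)

/-- Local analytic form at `-2m`. -/
noncomputable def locG (m : ℕ) (s : ℂ) : ℂ :=
  (Complex.Gamma s)⁻¹ * (mellin (Set.indicator (Set.Ioi (1:ℝ)) FT) s
    - deriv (PM fun n => (betC n : ℂ)) s
    + PM (Function.update (fun n => (kapR n : ℂ)) (2 * m + 1) 0) s)
  + kapR (2 * m + 1) * ((∏ j ∈ Finset.range (2 * m), (s + j)) *
      (Complex.Gamma (s + (2 * m + 1 : ℕ)))⁻¹)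

lemma PM_bet_analyticAt {s : ℂ} (h0 : s ≠ 0) (h1 : s ≠ 1)
    (h : ∀ m : ℕ, 1 ≤ m → s ≠ 1 - 2 * (m : ℂ)) : AnalyticAt ℂ (PM fun n => (betC n : ℂ)) s := by
  refine PM_analyticAt betC_summableC fun n => ?_
  rcases Nat.even_or_odd' n with ⟨k, rfl | rfl⟩
  · right
    rcases Nat.eq_zero_or_pos k with rfl | hk
    · simpa [sub_eq_zero] using h1
    · intro h2; apply h k hk; push_cast at h2; linear_combination h2
  · rcases Nat.eq_zero_or_pos k with rfl | hk
    · right; simpa using h0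
    · left; rw [betC_odd ⟨k, rfl⟩ (by omega)]; simp

lemma update_summable (N : ℕ) :
    Summable (fun n => ‖Function.update (fun n => (kapR n : ℂ)) N 0 n‖) := by
  refine Summable.of_nonneg_of_le (fun n => norm_nonneg _) (fun n => ?_) kapR_summable
  by_cases h : n = N
  · subst h; simp
  · rw [Function.update_of_ne h]

lemma locG_analyticAt {m : ℕ} (hm : 1 ≤ m) : AnalyticAt ℂ (locG m) (-(2 * (m : ℂ))) := by
  have hb : AnalyticAt ℂ (PM fun n => (betC n : ℂ)) (-(2 * (m : ℂ))) := by
    apply PM_bet_analyticAt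
    · simp; omega
    · intro h
      have h2 : (-(2 * (m:ℤ)) : ℤ) = 1 := by exact_mod_cast h
      omega
    · intro k hk h
      have h2 : (-(2 * (m:ℤ)) : ℤ) = 1 - 2 * k := by exact_mod_cast h
      omega
  have hk : AnalyticAt ℂ (PM (Function.update (fun n => (kapR n : ℂ)) (2 * m + 1) 0))
      (-(2 * (m : ℂ))) := by
    refine PM_analyticAt (update_summable _) fun n => ?_
    by_cases h : n = 2 * m + 1
    · left; subst h; simp
    · right; intro h2
      have h3 : (-(2 * (m:ℤ)) + n - 1 : ℤ) = 0 := by exact_mod_cast h2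
      omega
  have hp : AnalyticAt ℂ (fun s : ℂ => (∏ j ∈ Finset.range (2 * m), (s + j)))
      (-(2 * (m : ℂ))) := by
    apply Finset.analyticAt_fun_prod
    intro j _
    fun_prop
  have hG : AnalyticAt ℂ (fun s : ℂ => (Complex.Gamma (s + (2 * m + 1 : ℕ)))⁻¹) (-(2 * (m : ℂ))) :=
    AnalyticAt.fun_comp (g := fun s => (Complex.Gamma s)⁻¹) (invGamma_analyticAt _) (by fun_prop)
  exact ((invGamma_analyticAt _).mul (((tail_analyticAt _).sub hb.deriv).add hk)).add
    (analyticAt_const.mul (hp.mul hG))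

open Filter Topology in
lemma rawH_eq_locG (m : ℕ) : ∀ᶠ s in 𝓝[≠] (-(2 * (m : ℂ))), rawH s = locG m s := by
  obtain ⟨δ, hδ, h⟩ := exists_delta (-(2 * (m : ℂ)))
  have hball := nhdsWithin_le_nhds (s := {-(2 * (m : ℂ))}ᶜ)
    (Metric.ball_mem_nhds (-(2 * (m : ℂ))) hδ)
  filter_upwards [hball, self_mem_nhdsWithin] with s hs hs'
  have hne : s + 2 * m ≠ 0 := by
    intro h; apply hs'; simp only [Set.mem_singleton_iff]; linear_combination h
  have hPM : PM (fun n => (kapR n : ℂ)) s =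
      kapR (2 * m + 1) / (s + 2 * m) + PM (Function.update (fun n => (kapR n : ℂ)) (2 * m + 1) 0) s := by
    have hsum : Summable (fun n : ℕ => Function.update (fun n => (kapR n : ℂ)) (2 * m + 1) 0 n
        / (s + n - 1)) := by
      obtain ⟨δ', hδ', h'⟩ := exists_delta s
      refine Summable.of_norm_bounded (g := fun n =>
        ‖Function.update (fun n => (kapR n : ℂ)) (2 * m + 1) 0 n‖ / δ')
        ((update_summable _).div_const _) fun n => ?_
      rw [norm_div]
      by_cases h0 : s + n - 1 = 0
      · rw [h0]; simp; positivity
      · gcongr; exact h' n h0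
    have h1 := hasSum_ite_eq (2 * m + 1) ((kapR (2 * m + 1) : ℂ) / (s + 2 * m))
    have h2 := h1.add hsum.hasSum
    rw [PM, PM, ← h2.tsum_eq]
    refine tsum_congr fun n => ?_
    by_cases h : n = 2 * m + 1
    · subst h; simp; congr 1; ring
    · simp [h]
  rw [rawH, locG, hPM]
  have hG : (Complex.Gamma s)⁻¹ = (s + 2 * m) * ((∏ j ∈ Finset.range (2 * m), (s + j)) *
      (Complex.Gamma (s + (2 * m + 1 : ℕ)))⁻¹) := by
    rw [inv_Gamma_prod s (2 * m + 1), Finset.prod_range_succ]; push_cast; ring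
  have h4 : (Complex.Gamma s)⁻¹ * (kapR (2 * m + 1) / (s + 2 * m)) =
      kapR (2 * m + 1) * ((∏ j ∈ Finset.range (2 * m), (s + j)) *
      (Complex.Gamma (s + (2 * m + 1 : ℕ)))⁻¹) := by
    rw [hG]; field_simp
  rw [← h4]; ring

lemma locG_value {m : ℕ} (hm : 1 ≤ m) : locG m (-(2 * (m : ℂ))) =
    -((bernoulli (2 * m) : ℚ) : ℂ) / (4 * m) + ((bernoulli (2 * m) : ℚ) : ℂ) / 2 := by
  have h0 : Complex.Gamma (-(2 * (m : ℂ))) = 0 := by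
    have := Complex.Gamma_neg_nat_eq_zero (2 * m)
    push_cast at this; exact this
  have hprod : ∀ N : ℕ, (∏ j ∈ Finset.range N, (-(N : ℂ) + j)) = (-1) ^ N * N.factorial := by
    intro N
    rw [← Finset.prod_range_reflect, ← Finset.prod_range_add_one_eq_factorial, Nat.cast_prod]
    have : ((-1 : ℂ)) ^ N = ∏ j ∈ Finset.range N, (-1) := by simp
    rw [this, ← Finset.prod_mul_distrib]
    refine Finset.prod_congr rfl fun j hj => ?_
    have hj' : j < N := by simpa using hj
    have : ((N - 1 - j : ℕ) : ℂ) = N - 1 - j := by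
      rw [Nat.cast_sub (by omega), Nat.cast_sub (by omega)]; simp
    rw [this]; push_cast; ring
  have h1 := hprod (2 * m)
  push_cast at h1
  rw [locG, h0, h1]
  have h2 : (-(2 * (m : ℂ)) + (2 * m + 1 : ℕ)) = 1 := by push_cast; ring
  rw [h2, Complex.Gamma_one, inv_zero, zero_mul, zero_add, pow_mul]
  have h3 := congrArg (fun x : ℝ => (x : ℂ)) (kapR_odd hm)
  push_cast at h3
  simp only [even_two, Even.neg_pow, one_pow, one_mul, inv_one, mul_one]
  exact h3

/-- There is an analytic continuation `H` of the Euler sum `h(s) = Σ_{n=1}^∞ H_n n^{−s}`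
to `U = ℂ \ ({1, 0} ∪ {1 − 2m : m ≥ 1})`, with `H(−2m) = −B_{2m}/(4m) + B_{2m}/2` for every
integer `m ≥ 1`. -/
theorem eulerSum_value_at_neg_even :
    ∃ H : ℂ → ℂ, AnalyticOnNhd ℂ H eulerSumDomain ∧
      (∀ s : ℂ, 1 < s.re →
        H s = ∑' n : ℕ, ((harmonic (n + 1) : ℚ) : ℂ) * ((n + 1 : ℕ) : ℂ) ^ (-s)) ∧
      (∀ m : ℕ, 1 ≤ m →
        H (-(2 * (m : ℂ)))
          = -((bernoulli (2 * m) : ℚ) : ℂ) / (4 * m) + ((bernoulli (2 * m) : ℚ) : ℂ) / 2) := by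
  have hreg : ∀ s : ℂ, s ∈ eulerSumDomain → (∀ m : ℕ, 1 ≤ m → s ≠ -(2 * (m : ℂ))) →
      AnalyticAt ℂ rawH s := by
    intro s hs hs2
    have hs : s ≠ 1 ∧ s ≠ 0 ∧ ∀ m : ℕ, 1 ≤ m → s ≠ 1 - 2 * (m : ℂ) := hs
    have hk : AnalyticAt ℂ (PM fun n => (kapR n : ℂ)) s := by
      refine PM_analyticAt kapR_summable fun n => Or.inr ?_
      rcases Nat.even_or_odd' n with ⟨k, rfl | rfl⟩
      · rcases Nat.eq_zero_or_pos k with rfl | hk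
        · simpa [sub_eq_zero] using hs.1
        · intro h2; apply hs.2.2 k hk; push_cast at h2; linear_combination h2
      · rcases Nat.eq_zero_or_pos k with rfl | hk
        · simpa using hs.2.1
        · intro h2; apply hs2 k hk; push_cast at h2; linear_combination h2
    exact (invGamma_analyticAt _).mul (((tail_analyticAt _).sub
      (PM_bet_analyticAt hs.2.1 hs.1 hs.2.2).deriv).add hk)
  refine ⟨contH, ?_, ?_, ?_⟩
  · intro s hs
    by_cases h : ∀ m : ℕ, 1 ≤ m → s ≠ -(2 * (m : ℂ))
    · exact (hreg s hs h).congr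
        (contH_eventuallyEq (hreg s hs h) (Filter.Eventually.of_forall fun _ => rfl)).symm
    · push Not at h
      obtain ⟨m, hm, rfl⟩ := h
      exact (locG_analyticAt hm).congr (contH_eventuallyEq (locG_analyticAt hm) (rawH_eq_locG m)).symm
  · intro s hs
    have h : AnalyticAt ℂ rawH s := by
      have hm0 : ∀ m : ℕ, (0:ℝ) ≤ m := fun m => m.cast_nonneg
      apply hreg
      · change s ≠ 1 ∧ s ≠ 0 ∧ ∀ m : ℕ, 1 ≤ m → s ≠ 1 - 2 * (m : ℂ)
        refine ⟨?_, ?_, ?_⟩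
        · rintro rfl; simp at hs
        · rintro rfl; simp at hs; linarith
        · rintro m hm rfl; simp at hs; linarith [hm0 m]
      · rintro m hm rfl; simp at hs; linarith [hm0 m]
    rw [(contH_eventuallyEq h (Filter.Eventually.of_forall fun _ => rfl)).eq_of_nhds, rawH_eq hs]
  · intro m hm
    rw [(contH_eventuallyEq (locG_analyticAt hm) (rawH_eq_locG m)).eq_of_nhds, locG_value hm]
end

section
/- There exists a function H : ℂ → ℂ analytic on U = { s ∈ ℂ : s ≠ 1, s ≠ 0, and s ≠ 1 − 2m for every integer m ≥ 1 }, with H(s) = Σ_{n=1}^∞ H_n n^{−s} for all Re(s) > 1, such that the function s ↦ H(s) − 1/(2s) tends to (1 + γ)/2 as s → 0 within U, where γ is the Euler–Mascheroni constant. In particular, H has a simple pole at s = 0 with residue 1/2 and h(s) = 1/(2s) + (1 + γ)/2 + O(s) near 0. -/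
open Complex Filter Topology

namespace EulerSumAux

/-- factor `u` out of an analytic function vanishing at zero -/
lemma factor_one {D : ℝ → ℝ} {d : ℝ} (hD : AnalyticAt ℝ D 0) (h0 : D 0 = 0)
    (hd : HasDerivAt D d 0) :
    ∃ g : ℝ → ℝ, AnalyticAt ℝ g 0 ∧ g 0 = d ∧ ∀ᶠ u in 𝓝 0, D u = u * g u := by
  obtain ⟨g, hg, he⟩ := hD.exists_eventuallyEq_sum_add_pow_mul 1
  have he' : ∀ᶠ u in 𝓝 0, D u = u * g u := by
    filter_upwards [he] with u hu
    simpa [h0] using hu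
  refine ⟨g, hg, ?_, he'⟩
  have h1 : HasDerivAt (fun u => u * g u) (1 * g 0 + 0 * deriv g 0) 0 :=
    (hasDerivAt_id (0 : ℝ)).mul hg.differentiableAt.hasDerivAt
  have h2 := (h1.congr_of_eventuallyEq he').unique hd
  simpa using h2

lemma odd_step {f g : ℝ → ℝ} {m : ℕ} (hm : Odd m) (hodd : ∀ u, f (-u) = - f u)
    (hg : AnalyticAt ℝ g 0) (hfg : ∀ᶠ u in 𝓝 0, f u = u ^ m * g u) (h0 : g 0 = 0) :
    ∃ F : ℝ → ℝ, AnalyticAt ℝ F 0 ∧ ∀ᶠ u in 𝓝 0, f u = u ^ (m + 2) * F u := by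
  obtain ⟨F, hF, he⟩ := hg.exists_eventuallyEq_sum_add_pow_mul 2
  set a := deriv g 0 with ha
  have he' : ∀ᶠ u in 𝓝 0, g u = u * a + u ^ 2 * F u := by
    filter_upwards [he] with u hu
    simpa [Finset.sum_range_succ, h0, ha] using hu
  have hneg : Tendsto (fun u : ℝ => -u) (𝓝 0) (𝓝 0) := by
    simpa using (continuous_neg (G := ℝ)).tendsto 0
  have ha0 : a = 0 := by
    have key : ∀ᶠ u in 𝓝[≠] (0 : ℝ), 2 * a = u * (F (-u) - F u) := by
      rw [eventually_nhdsWithin_iff]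
      filter_upwards [he', hneg.eventually he', hfg, hneg.eventually hfg] with u h1 h2 h3 h4 hu
      have hu : u ≠ 0 := hu
      have h5 := hodd u
      rw [h4, h3, hm.neg_pow, h1, h2] at h5
      have h6 : u ^ (m + 1) * (2 * a) = u ^ (m + 1) * (u * (F (-u) - F u)) := by
        linear_combination h5
      exact mul_left_cancel₀ (pow_ne_zero _ hu) h6
    have hFc := hF.continuousAt.tendsto
    have hF' : Tendsto (fun u => F (-u)) (𝓝 0) (𝓝 (F 0)) := hFc.comp hneg
    have l1 : Tendsto (fun u : ℝ => u * (F (-u) - F u)) (𝓝[≠] 0) (𝓝 (0 * (F 0 - F 0))) :=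
      (Tendsto.mul tendsto_id (hF'.sub hFc)).mono_left nhdsWithin_le_nhds
    have l2 : Tendsto (fun _ : ℝ => 2 * a) (𝓝[≠] 0) (𝓝 (2 * a)) := tendsto_const_nhds
    have := tendsto_nhds_unique l2 (l1.congr' (key.mono fun _ h => h.symm))
    linarith
  refine ⟨F, hF, ?_⟩
  filter_upwards [he', hfg] with u h1 h2
  rw [h2, h1, ha0]; ring

/-- difference of `n ^ (-2k)` in the midpoint variable -/
noncomputable def T (k : ℕ) (u : ℝ) : ℝ :=
  u ^ (2 * k) * (((1 + u / 2) ^ (2 * k))⁻¹ - ((1 - u / 2) ^ (2 * k))⁻¹)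

noncomputable def phi0 (u : ℝ) : ℝ :=
  u / 2 * ((1 + u / 2)⁻¹ + (1 - u / 2)⁻¹) - (Real.log (1 + u / 2) - Real.log (1 - u / 2))

lemma T_odd (k : ℕ) (u : ℝ) : T k (-u) = - T k u := by
  unfold T
  rw [Even.neg_pow (even_two_mul k), show 1 + -u / 2 = 1 - u / 2 by ring,
    show 1 - -u / 2 = 1 + u / 2 by ring]
  ring

lemma phi0_odd (u : ℝ) : phi0 (-u) = - phi0 u := by
  unfold phi0
  rw [show 1 + -u / 2 = 1 - u / 2 by ring,
    show 1 - -u / 2 = 1 + u / 2 by ring]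
  ring

lemma T_factor (k : ℕ) : ∃ g : ℝ → ℝ, AnalyticAt ℝ g 0 ∧ g 0 = -(2 * k : ℝ) ∧
    ∀ᶠ u in 𝓝 0, T k u = u ^ (2 * k + 1) * g u := by
  have h1 : HasDerivAt (fun u : ℝ => 1 + u / 2) (1 / 2) 0 :=
    ((hasDerivAt_id (0 : ℝ)).div_const 2).const_add 1
  have h2 : HasDerivAt (fun u : ℝ => 1 - u / 2) (-(1 / 2)) 0 :=
    ((hasDerivAt_id (0 : ℝ)).div_const 2).const_sub 1
  have hd := ((h1.fun_pow (2 * k)).fun_inv (by simp)).fun_sub ((h2.fun_pow (2 * k)).fun_inv (by simp))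
  obtain ⟨g, hg, hg0, he⟩ := factor_one
    (D := fun u : ℝ => ((1 + u / 2) ^ (2 * k))⁻¹ - ((1 - u / 2) ^ (2 * k))⁻¹)
    (by
      apply AnalyticAt.fun_sub
      · apply AnalyticAt.fun_inv
        · fun_prop
        · simp
      · apply AnalyticAt.fun_inv
        · fun_prop
        · simp)
    (by simp) hd
  refine ⟨g, hg, ?_, ?_⟩
  · rw [hg0]; simp; ring
  · filter_upwards [he] with u hu
    unfold T
    rw [hu]; ring

lemma phi0_factor : ∃ F : ℝ → ℝ, AnalyticAt ℝ F 0 ∧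
    ∀ᶠ u in 𝓝 0, phi0 u = u ^ 3 * F u := by
  have h1 : HasDerivAt (fun u : ℝ => 1 + u / 2) (1 / 2) 0 :=
    ((hasDerivAt_id (0 : ℝ)).div_const 2).const_add 1
  have h2 : HasDerivAt (fun u : ℝ => 1 - u / 2) (-(1 / 2)) 0 :=
    ((hasDerivAt_id (0 : ℝ)).div_const 2).const_sub 1
  have hd := (((hasDerivAt_id' (0 : ℝ)).div_const 2).fun_mul
    ((h1.fun_inv (by simp)).fun_add (h2.fun_inv (by simp)))).fun_sub
    ((h1.log (by simp)).fun_sub (h2.log (by simp)))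
  obtain ⟨g, hg, hg0, he⟩ := factor_one (D := phi0)
    (by
      unfold phi0
      apply AnalyticAt.fun_sub
      · apply AnalyticAt.fun_mul (by fun_prop)
        apply AnalyticAt.fun_add
        · apply AnalyticAt.fun_inv (by fun_prop); simp
        · apply AnalyticAt.fun_inv (by fun_prop); simp
      · apply AnalyticAt.fun_sub
        · apply AnalyticAt.log (by fun_prop); simp
        · apply AnalyticAt.log (by fun_prop); simp)
    (by simp [phi0]) hd
  refine odd_step (m := 1) (by decide) phi0_odd hg (by simpa using he) ?_
  rw [hg0]; norm_num

/-- the inductive package -/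
def Good (K : ℕ) (f : ℝ → ℝ) : Prop :=
  (∀ u, f (-u) = - f u) ∧ ∃ F : ℝ → ℝ, AnalyticAt ℝ F 0 ∧
    ∀ᶠ u in 𝓝 0, f u = u ^ (2 * K + 3) * F u

lemma good_step (K : ℕ) (f : ℝ → ℝ) (h : Good K f) :
    ∃ c : ℝ, Good (K + 1) (fun u => f u - c * T (K + 1) u) := by
  obtain ⟨ho, F, hF, he⟩ := h
  obtain ⟨g, hg, hg0, heg⟩ := T_factor (K + 1)
  have hne : g 0 ≠ 0 := by rw [hg0]; push_cast; simp; positivity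
  refine ⟨F 0 / g 0, fun u => by simp only [ho, T_odd]; ring, ?_⟩
  refine odd_step (m := 2 * K + 3) (g := fun u => F u - F 0 / g 0 * g u) ⟨K + 1, by ring⟩
    (fun u => by simp only [ho, T_odd]; ring) (by fun_prop) ?_ (by field_simp; simp)
  filter_upwards [he, heg] with u h1 h2
  rw [h1, h2]; ring

noncomputable def seqAux : (K : ℕ) → {f : ℝ → ℝ // Good K f}
  | 0 => ⟨phi0, phi0_odd, by simpa using phi0_factor⟩
  | K + 1 => ⟨_, (good_step K (seqAux K).1 (seqAux K).2).choose_spec⟩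

/-- the coefficients of the asymptotic expansion of the harmonic numbers -/
noncomputable def cf (K : ℕ) : ℝ := (good_step K (seqAux K).1 (seqAux K).2).choose

lemma seqAux_eq (K : ℕ) (u : ℝ) :
    (seqAux K).1 u = phi0 u - ∑ k ∈ Finset.range K, cf k * T (k + 1) u := by
  induction K with
  | zero => simp [seqAux]
  | succ K ih =>
    rw [Finset.sum_range_succ, ← sub_sub, ← ih]
    rfl

/-- remainder of the asymptotic expansion -/
noncomputable def rr (K n : ℕ) : ℝ :=
  (harmonic n : ℝ) - Real.log n - Real.eulerMascheroniConstant - (1 / 2) * (n : ℝ)⁻¹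
    - ∑ k ∈ Finset.range K, cf k * ((n : ℝ) ^ (2 * (k + 1)))⁻¹

lemma rr_diff (K n : ℕ) (hn : n ≠ 0) :
    rr K (n + 1) - rr K n = (seqAux K).1 (1 / ((n : ℝ) + 1 / 2)) := by
  rw [seqAux_eq]
  have hn' : (0 : ℝ) < n := by positivity
  set u : ℝ := 1 / ((n : ℝ) + 1 / 2) with hu
  have hu0 : 0 < u := by positivity
  have e1 : 1 + u / 2 = ((n : ℝ) + 1) * u := by rw [hu]; field_simp; ring
  have e2 : 1 - u / 2 = (n : ℝ) * u := by rw [hu]; field_simp; ring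
  have hT : ∀ k, T k u = (((n : ℝ) + 1) ^ (2 * k))⁻¹ - ((n : ℝ) ^ (2 * k))⁻¹ := by
    intro k
    unfold T
    rw [e1, e2, mul_pow, mul_pow]
    field_simp
  have hp : phi0 u = 1 / 2 * ((n : ℝ) + 1)⁻¹ + 1 / 2 * (n : ℝ)⁻¹
      - (Real.log (n + 1) - Real.log n) := by
    unfold phi0
    rw [e1, e2, Real.log_mul (by positivity) hu0.ne', Real.log_mul hn'.ne' hu0.ne']
    field_simp
    ring
  simp only [hT, hp, rr, harmonic_succ]
  push_cast
  simp only [mul_sub, Finset.sum_sub_distrib]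
  ring

lemma rr_tendsto (K : ℕ) : Tendsto (rr K) atTop (𝓝 0) := by
  have hinv : Tendsto (fun n : ℕ => ((n : ℝ))⁻¹) atTop (𝓝 0) := tendsto_inv_atTop_nhds_zero_nat
  have h1 := ((Real.tendsto_harmonic_sub_log.sub_const Real.eulerMascheroniConstant).sub
    (hinv.const_mul (1 / 2)))
  have h2 : Tendsto (fun n : ℕ => ∑ k ∈ Finset.range K, cf k * ((n : ℝ) ^ (2 * (k + 1)))⁻¹) atTop
      (𝓝 (∑ k ∈ Finset.range K, cf k * 0)) := by
    refine tendsto_finsetSum _ fun k _ => Tendsto.const_mul _ ?_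
    have := hinv.pow (2 * (k + 1))
    simpa using this
  have h3 := h1.sub h2
  simp only [sub_self, mul_zero, Finset.sum_const_zero] at h3
  exact h3

lemma tail_bound {r : ℕ → ℝ} (hr : Tendsto r atTop (𝓝 0)) {C : ℝ} (hC : 0 ≤ C) {p N : ℕ}
    (hN : 1 ≤ N)
    (h : ∀ n ≥ N, |r (n + 1) - r n| ≤ C * ((n + 1 : ℝ)⁻¹) ^ (p + 2)) :
    ∀ n ≥ N, |r n| ≤ C * ((n : ℝ)⁻¹) ^ (p + 1) := by
  have hinv : Tendsto (fun n : ℕ => C * ((n : ℝ)⁻¹) ^ (p + 1)) atTop (𝓝 0) := by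
    have := (tendsto_inv_atTop_nhds_zero_nat (𝕜 := ℝ)).pow (p + 1)
    simpa using this.const_mul C
  have key : ∀ n ≥ N, |r (n + 1) - r n| ≤
      C * ((n : ℝ)⁻¹) ^ (p + 1) - C * (((n + 1 : ℕ) : ℝ)⁻¹) ^ (p + 1) := by
    intro n hn
    refine (h n hn).trans ?_
    rw [← mul_sub]
    refine mul_le_mul_of_nonneg_left ?_ hC
    have hn0 : (0 : ℝ) < n := by exact_mod_cast (by omega : 0 < n)
    push_cast
    set a := (n : ℝ)⁻¹ with ha
    set b := (n + 1 : ℝ)⁻¹ with hb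
    have hb0 : 0 < b := by positivity
    have hab : b ≤ a := by rw [ha, hb]; gcongr; linarith
    have hab' : a - b = a * b := by rw [ha, hb]; field_simp; ring
    have h1 : b ^ p ≤ a ^ p := by gcongr
    have h2 : b * b ≤ a - b := by rw [hab']; gcongr
    calc b ^ (p + 2) = b * b * b ^ p := by ring
      _ ≤ (a - b) * b ^ p := by gcongr
      _ = a * b ^ p - b ^ (p + 1) := by ring
      _ ≤ a * a ^ p - b ^ (p + 1) := by gcongr
      _ = _ := by ring
  intro n hn
  rw [abs_le]
  constructor
  · have hanti : Antitone (fun j : ℕ => r (n + j) + C * (((n + j : ℕ) : ℝ)⁻¹) ^ (p + 1)) := by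
      refine antitone_nat_of_succ_le fun j => ?_
      have := (abs_le.1 (key (n + j) (by omega))).2
      rw [← add_assoc]
      linarith
    have hl : Tendsto (fun j : ℕ => r (n + j) + C * (((n + j : ℕ) : ℝ)⁻¹) ^ (p + 1)) atTop
        (𝓝 0) := by
      have := (hr.add hinv).comp (tendsto_add_atTop_nat n)
      simp only [add_zero, sub_zero] at this
      refine this.congr fun j => ?_
      simp [add_comm]
    have := hanti.le_of_tendsto hl 0
    simp at this ⊢
    linarith
  · have hmono : Monotone (fun j : ℕ => r (n + j) - C * (((n + j : ℕ) : ℝ)⁻¹) ^ (p + 1)) := by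
      refine monotone_nat_of_le_succ fun j => ?_
      have := (abs_le.1 (key (n + j) (by omega))).1
      rw [← add_assoc]
      linarith
    have hl : Tendsto (fun j : ℕ => r (n + j) - C * (((n + j : ℕ) : ℝ)⁻¹) ^ (p + 1)) atTop
        (𝓝 0) := by
      have := (hr.sub hinv).comp (tendsto_add_atTop_nat n)
      simp only [add_zero, sub_zero] at this
      refine this.congr fun j => ?_
      simp [add_comm]
    have := hmono.ge_of_tendsto hl 0
    simp at this ⊢
    linarith

lemma rr_bound (K : ℕ) : ∃ C : ℝ, ∃ N : ℕ, 1 ≤ N ∧ ∀ n ≥ N,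
    |rr K n| ≤ C * ((n : ℝ)⁻¹) ^ (2 * K + 2) := by
  obtain ⟨-, F, hF, he⟩ := (seqAux K).2
  have hb : ∀ᶠ u in 𝓝 (0 : ℝ), |F u| ≤ |F 0| + 1 := by
    have := hF.continuousAt.abs.tendsto.eventually (gt_mem_nhds (lt_add_one |F 0|))
    exact this.mono fun _ h => le_of_lt h
  have hu : Tendsto (fun n : ℕ => 1 / ((n : ℝ) + 1 / 2)) atTop (𝓝 0) := by
    have : Tendsto (fun n : ℕ => (n : ℝ) + 1 / 2) atTop atTop :=
      tendsto_atTop_add_const_right _ _ tendsto_natCast_atTop_atTop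
    have h2 := this.inv_tendsto_atTop
    refine h2.congr fun n => ?_
    simp
  obtain ⟨N, hN⟩ := eventually_atTop.1 (hu.eventually (he.and hb))
  refine ⟨(|F 0| + 1) * 2 ^ (2 * K + 3), max N 1, le_max_right _ _, ?_⟩
  refine tail_bound (rr_tendsto K) (by positivity) (le_max_right _ _) ?_
  intro n hn
  have hn1 : 1 ≤ n := (le_max_right _ _).trans hn
  obtain ⟨h1, h2⟩ := hN n ((le_max_left _ _).trans hn)
  rw [rr_diff K n (by omega), h1, abs_mul, abs_pow]
  have h3 : |1 / ((n : ℝ) + 1 / 2)| ≤ 2 * (n + 1 : ℝ)⁻¹ := by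
    rw [abs_of_pos (by positivity), ← div_eq_mul_inv, div_le_div_iff₀ (by positivity) (by positivity)]
    linarith
  calc _ ≤ (2 * (n + 1 : ℝ)⁻¹) ^ (2 * K + 3) * (|F 0| + 1) := by gcongr
    _ = _ := by ring

end EulerSumAux

namespace EulerSumAux

open LSeries

/-- complex version of the remainder -/
noncomputable def rc (K n : ℕ) : ℂ := (rr K n : ℂ)

lemma rc_absc (K : ℕ) : abscissaOfAbsConv (rc K) ≤ ((-(2 * K + 2) : ℝ) : EReal) + 1 := by
  apply LSeries.abscissaOfAbsConv_le_of_isBigO_rpow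
  obtain ⟨C, N, hN, h⟩ := rr_bound K
  refine Asymptotics.IsBigO.of_bound C ?_
  filter_upwards [eventually_ge_atTop N] with n hn
  have h1 := h n hn
  have h2 : (n : ℝ) ^ (-(2 * K + 2) : ℝ) = ((n : ℝ)⁻¹) ^ (2 * K + 2) := by
    rw [Real.rpow_neg (by positivity), inv_pow, ← Real.rpow_natCast]
    push_cast; rfl
  rw [h2, Real.norm_of_nonneg (by positivity)]
  simpa [rc] using h1

lemma rc_lt (K : ℕ) {s : ℂ} (hs : -(2 * K + 1 : ℝ) < s.re) :
    abscissaOfAbsConv (rc K) < s.re := by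
  refine (rc_absc K).trans_lt ?_
  have : ((-(2 * K + 2) : ℝ) : EReal) + 1 = ((-(2 * K + 2) + 1 : ℝ) : EReal) := by
    rw [EReal.coe_add]; rfl
  rw [this, EReal.coe_lt_coe_iff]
  linarith

lemma pow_hasSum (j : ℕ) {s : ℂ} (hs : 1 < (s + j).re) :
    LSeriesHasSum (fun n : ℕ => ((n : ℂ) ^ j)⁻¹) s (riemannZeta (s + j)) := by
  have h := LSeriesHasSum_one hs
  unfold LSeriesHasSum at h ⊢
  convert h using 1
  funext n
  rcases eq_or_ne n 0 with rfl | hn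
  · simp
  · have hn' : (n : ℂ) ≠ 0 := by exact_mod_cast hn
    rw [term_of_ne_zero hn, term_of_ne_zero hn, Complex.cpow_add _ _ hn', Complex.cpow_natCast]
    simp only [Pi.one_apply]
    field_simp

noncomputable def G (K : ℕ) (s : ℂ) : ℂ :=
  -deriv riemannZeta s + Real.eulerMascheroniConstant * riemannZeta s
    + (1 / 2) * riemannZeta (s + 1)
    + ∑ k ∈ Finset.range K, (cf k : ℂ) * riemannZeta (s + (2 * (k + 1) : ℕ))
    + LSeries (rc K) s

lemma G_succ (K : ℕ) {s : ℂ} (hs : -(2 * K + 1 : ℝ) < s.re) : G K s = G (K + 1) s := by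
  have hz := pow_hasSum (2 * (K + 1)) (s := s) (by
    rw [Complex.add_re, Complex.natCast_re]; push_cast; linarith)
  have h1 : LSeriesSummable (rc (K + 1)) s :=
    LSeriesSummable_of_abscissaOfAbsConv_lt_re (rc_lt (K + 1) (by push_cast; linarith))
  have h2 : LSeries (rc K) s = LSeries (rc (K + 1)) s
      + (cf K : ℂ) * riemannZeta (s + (2 * (K + 1) : ℕ)) := by
    rw [← hz.LSeries_eq, ← LSeries_smul, ← LSeries_add h1 (hz.LSeriesSummable.smul _)]
    congr 1
    funext n
    simp only [rc, rr, Finset.sum_range_succ, Pi.add_apply, Pi.smul_apply, smul_eq_mul]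
    push_cast
    ring
  simp only [G, Finset.sum_range_succ, h2]
  ring

lemma G_add (K j : ℕ) {s : ℂ} (hs : -(2 * K + 1 : ℝ) < s.re) : G K s = G (K + j) s := by
  induction j with
  | zero => rfl
  | succ j ih =>
    rw [ih, ← add_assoc]
    exact G_succ _ (by push_cast; have : (0 : ℝ) ≤ j := by positivity
                       linarith)

noncomputable def HH (s : ℂ) : ℂ := G ⌈|s.re|⌉₊ s

lemma HH_eq (K : ℕ) {s : ℂ} (hs : -(2 * K + 1 : ℝ) < s.re) : HH s = G K s := by
  have h1 : -(2 * (⌈|s.re|⌉₊ : ℕ) + 1 : ℝ) < s.re := by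
    have := Nat.le_ceil |s.re|
    have h2 := neg_abs_le s.re
    have h3 := abs_nonneg s.re
    linarith
  unfold HH
  rw [G_add _ K h1, G_add K ⌈|s.re|⌉₊ hs, add_comm]

lemma zeta_analyticAt {s : ℂ} (hs : s ≠ 1) : AnalyticAt ℂ riemannZeta s := by
  rw [Complex.analyticAt_iff_eventually_differentiableAt]
  filter_upwards [isOpen_ne.mem_nhds hs] with z hz
  exact differentiableAt_riemannZeta hz

lemma zeta_shift_analyticAt {s a : ℂ} (hs : s + a ≠ 1) :
    AnalyticAt ℂ (fun z => riemannZeta (z + a)) s :=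
  (zeta_analyticAt hs).fun_comp (f := fun z => z + a) (by fun_prop)

lemma L_analyticAt (K : ℕ) {s : ℂ} (hs : -(2 * K + 1 : ℝ) < s.re) :
    AnalyticAt ℂ (LSeries (rc K)) s := LSeries_analyticOnNhd _ s (rc_lt K hs)

lemma G_analyticAt (K : ℕ) {s : ℂ} (hs : -(2 * K + 1 : ℝ) < s.re) (h : s ∈ eulerSumDomain) :
    AnalyticAt ℂ (G K) s := by
  obtain ⟨h1, h0, hm⟩ := h
  have hz := zeta_analyticAt h1
  have hz' := hz.deriv
  have hz1 : AnalyticAt ℂ (fun z => riemannZeta (z + 1)) s :=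
    zeta_shift_analyticAt (by simpa using h0)
  have hL := L_analyticAt K hs
  have hS : AnalyticAt ℂ (fun z => ∑ k ∈ Finset.range K,
      (cf k : ℂ) * riemannZeta (z + (2 * (k + 1) : ℕ))) s := by
    refine Finset.analyticAt_fun_sum _ fun k _ => ?_
    refine AnalyticAt.fun_mul analyticAt_const (zeta_shift_analyticAt ?_)
    intro he
    apply hm (k + 1) (by omega)
    rw [← he]; push_cast; ring
  unfold G
  fun_prop

lemma HH_analytic : AnalyticOnNhd ℂ HH eulerSumDomain := by
  intro s hs
  obtain ⟨K, hK⟩ := exists_nat_gt |s.re|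
  have h1 : -(2 * K + 1 : ℝ) < s.re := by
    have h2 := neg_abs_le s.re
    have h3 := abs_nonneg s.re
    linarith
  refine (G_analyticAt K h1 hs).congr ?_
  have : {z : ℂ | -(2 * K + 1 : ℝ) < z.re} ∈ 𝓝 s :=
    (isOpen_lt continuous_const Complex.continuous_re).mem_nhds h1
  filter_upwards [this] with z hz
  exact (HH_eq K hz).symm

lemma HH_series (s : ℂ) (hs : 1 < s.re) :
    HH s = ∑' n : ℕ, ((harmonic (n + 1) : ℚ) : ℂ) * ((n + 1 : ℕ) : ℂ) ^ (-s) := by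
  have e1 : (1 : EReal) < s.re := by exact_mod_cast hs
  rw [HH_eq 0 (by push_cast; linarith)]
  have a1 : abscissaOfAbsConv 1 < s.re := by rw [LSeries.abscissaOfAbsConv_one]; exact e1
  have hlog : LSeriesHasSum (logMul 1) s (-deriv riemannZeta s) := by
    have h := (LSeriesSummable_logMul_of_lt_re a1).LSeriesHasSum
    have h2 := LSeries_deriv a1
    have h3 : deriv (LSeries 1) s = deriv riemannZeta s := by
      apply Filter.EventuallyEq.deriv_eq
      filter_upwards [(isOpen_lt continuous_const Complex.continuous_re).mem_nhds hs] with z hz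
      exact LSeries_one_eq_riemannZeta hz
    rw [← h3, h2, neg_neg]
    exact h
  have hz := LSeriesHasSum_one hs
  have hz1 := pow_hasSum 1 (s := s) (by simp; linarith)
  have hr := (LSeriesSummable_of_abscissaOfAbsConv_lt_re
    (rc_lt 0 (s := s) (by push_cast; linarith))).LSeriesHasSum
  have htot := ((hlog.add (hz.smul (Real.eulerMascheroniConstant : ℂ))).add
    (hz1.smul (1 / 2 : ℂ))).add hr
  have hG : G 0 s = -deriv riemannZeta s + (Real.eulerMascheroniConstant : ℂ) * riemannZeta s
    + (1 / 2 : ℂ) * riemannZeta (s + (1 : ℕ)) + LSeries (rc 0) s := by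
    simp [G]
  rw [hG]
  unfold LSeriesHasSum at htot
  rw [← htot.tsum_eq, htot.summable.tsum_eq_zero_add, term_zero, zero_add]
  refine tsum_congr fun n => ?_
  rw [term_of_ne_zero (by omega), div_eq_mul_inv, Complex.cpow_neg]
  congr 1
  have hl : Complex.log ((n + 1 : ℕ) : ℂ) = ((Real.log (n + 1 : ℕ) : ℝ) : ℂ) := by
    rw [Complex.natCast_log]
  simp only [Pi.add_apply, Pi.smul_apply, logMul, hl, rc, rr, Pi.one_apply, smul_eq_mul]
  push_cast
  simp
  
lemma sum_rr (N : ℕ) : ∑ n ∈ Finset.range (N + 1), (if n = 0 then 0 else rr 0 n) =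
    (N + 1 / 2) * (harmonic N : ℝ) - N - Real.log (N.factorial)
      - Real.eulerMascheroniConstant * N := by
  induction N with
  | zero => simp
  | succ N ih =>
    rw [Finset.sum_range_succ, ih, if_neg (by omega), Nat.factorial_succ]
    push_cast
    rw [Real.log_mul (by positivity) (by positivity)]
    simp only [rr, harmonic_succ]
    push_cast
    simp
    field_simp
    ring

lemma sum_rr' (N : ℕ) (hN : N ≠ 0) :
    ∑ n ∈ Finset.range (N + 1), (if n = 0 then 0 else rr 0 n) =
    (N * rr 0 N + 1 / 2 * rr 0 N + 1 / 4 * (N : ℝ)⁻¹) +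
      ((1 + Real.eulerMascheroniConstant) / 2 - Real.log (Stirling.stirlingSeq N)
        - Real.log 2 / 2) := by
  have hN' : (0 : ℝ) < N := by positivity
  rw [sum_rr, Stirling.log_stirlingSeq_formula, Real.log_mul (by norm_num) hN'.ne',
    Real.log_div hN'.ne' (by positivity), Real.log_exp]
  simp only [rr, Finset.range_zero, Finset.sum_empty]
  field_simp
  ring

lemma tendsto_sum_rr : Tendsto
    (fun N : ℕ => ∑ n ∈ Finset.range (N + 1), (if n = 0 then 0 else rr 0 n)) atTop
    (𝓝 ((1 + Real.eulerMascheroniConstant) / 2 - Real.log (2 * Real.pi) / 2)) := by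
  have hinv : Tendsto (fun n : ℕ => ((n : ℝ))⁻¹) atTop (𝓝 0) := tendsto_inv_atTop_nhds_zero_nat
  have h1 : Tendsto (fun N : ℕ => (N : ℝ) * rr 0 N) atTop (𝓝 0) := by
    obtain ⟨C, N, hN, h⟩ := rr_bound 0
    refine squeeze_zero_norm' (a := fun n : ℕ => C * (n : ℝ)⁻¹) ?_ (by simpa using hinv.const_mul C)
    filter_upwards [eventually_ge_atTop N] with n hn
    have hn' : (0 : ℝ) < n := by exact_mod_cast (by omega : 0 < n)
    rw [norm_mul, Real.norm_eq_abs, Real.norm_eq_abs, abs_of_pos hn']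
    calc _ ≤ (n : ℝ) * (C * ((n : ℝ)⁻¹) ^ (2 * 0 + 2)) := by
          gcongr; exact h n hn
      _ = _ := by rw [show 2 * 0 + 2 = 2 from rfl]; field_simp
  have h2 := (rr_tendsto 0).const_mul (1 / 2)
  have h3 := hinv.const_mul (1 / 4)
  have h4 := Stirling.tendsto_stirlingSeq_sqrt_pi.log (by positivity)
  have h5 := ((h1.add h2).add h3).add
    ((h4.const_sub ((1 + Real.eulerMascheroniConstant) / 2)).sub_const (Real.log 2 / 2))
  have e : (0 + 1 / 2 * 0 + 1 / 4 * 0 : ℝ) + ((1 + Real.eulerMascheroniConstant) / 2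
      - Real.log √Real.pi - Real.log 2 / 2)
      = (1 + Real.eulerMascheroniConstant) / 2 - Real.log (2 * Real.pi) / 2 := by
    rw [Real.log_sqrt (by positivity), Real.log_mul (by norm_num) (by positivity)]
    ring
  rw [e] at h5
  refine h5.congr' ?_
  filter_upwards [eventually_ne_atTop 0] with N hN
  exact (sum_rr' N hN).symm

lemma L_zero : LSeries (rc 0) 0 =
    (((1 + Real.eulerMascheroniConstant) / 2 - Real.log (2 * Real.pi) / 2 : ℝ) : ℂ) := by
  have hs : LSeriesHasSum (rc 0) 0 _ := (LSeriesSummable_of_abscissaOfAbsConv_lt_re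
    (rc_lt 0 (s := 0) (by simp))).LSeriesHasSum
  have h1 := (HasSum.tendsto_sum_nat hs).comp (tendsto_add_atTop_nat 1)
  have h2 := (Complex.continuous_ofReal.tendsto _).comp tendsto_sum_rr
  refine tendsto_nhds_unique h1 (h2.congr fun N => ?_)
  simp only [Function.comp]
  rw [Complex.ofReal_sum]
  refine Finset.sum_congr rfl fun n _ => ?_
  rw [term_def]
  split_ifs <;> simp [rc]

lemma HH_tendsto : Tendsto (fun s : ℂ => HH s - 1 / (2 * s)) (𝓝[eulerSumDomain] 0)
        (𝓝 ((1 + (Real.eulerMascheroniConstant : ℂ)) / 2)) := by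
  have hsub : 𝓝[eulerSumDomain] (0 : ℂ) ≤ 𝓝[≠] 0 := nhdsWithin_mono _ fun s hs => hs.2.1
  refine Tendsto.mono_left ?_ hsub
  have hz := zeta_analyticAt (s := 0) (by simp)
  have t1 := hz.deriv.continuousAt.tendsto.neg
  have t2 := hz.continuousAt.tendsto.const_mul (Real.eulerMascheroniConstant : ℂ)
  have t3 := (L_analyticAt 0 (s := 0) (by simp)).continuousAt.tendsto
  have t4 : Tendsto (fun s : ℂ => riemannZeta (s + 1) - 1 / s) (𝓝[≠] 0)
      (𝓝 Real.eulerMascheroniConstant) := by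
    have hsh : Tendsto (fun s : ℂ => s + 1) (𝓝[≠] 0) (𝓝[≠] 1) := by
      refine tendsto_nhdsWithin_iff.2 ⟨?_, ?_⟩
      · have : Tendsto (fun s : ℂ => s + 1) (𝓝 0) (𝓝 (0 + 1)) :=
          (continuous_id.add continuous_const).tendsto 0
        rw [zero_add] at this
        exact this.mono_left nhdsWithin_le_nhds
      · filter_upwards [self_mem_nhdsWithin] with s hs
        simpa using hs
    refine (tendsto_riemannZeta_sub_one_div.comp hsh).congr fun s => ?_
    simp
  have t := (((t1.add t2).add t3).mono_left (nhdsWithin_le_nhds (s := {0}ᶜ))).add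
    (t4.const_mul (1 / 2))
  have e : -deriv riemannZeta 0 + (Real.eulerMascheroniConstant : ℂ) * riemannZeta 0
      + LSeries (rc 0) 0 + 1 / 2 * (Real.eulerMascheroniConstant : ℂ)
      = (1 + (Real.eulerMascheroniConstant : ℂ)) / 2 := by
    rw [L_zero, riemannZeta_zero, deriv_riemannZeta_zero]
    have : Complex.log (2 * Real.pi) = ((Real.log (2 * Real.pi) : ℝ) : ℂ) := by
      rw [Complex.ofReal_log (by positivity)]; push_cast; rfl
    rw [this]
    push_cast
    ring
  rw [e] at t
  refine t.congr' ?_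
  have hn : {z : ℂ | -1 < z.re} ∈ 𝓝[≠] (0 : ℂ) := mem_nhdsWithin_of_mem_nhds
    ((isOpen_lt continuous_const Complex.continuous_re).mem_nhds (by simp))
  filter_upwards [hn, self_mem_nhdsWithin] with s hs hs0
  have hs0 : s ≠ 0 := hs0
  have hs : -1 < s.re := hs
  rw [HH_eq 0 (by push_cast; linarith)]
  simp only [G, Finset.range_zero, Finset.sum_empty]
  field_simp
  ring

end EulerSumAux

/-- There is an analytic continuation `H` of the Euler sum `h(s) = Σ_{n=1}^∞ H_n n^{−s}`
to `U = ℂ \ ({1, 0} ∪ {1 − 2m : m ≥ 1})`, such that `H(s) − 1/(2s) → (1 + γ)/2` as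
`s → 0` within `U` (so `H` has a simple pole at `0` with residue `1/2` and
`h(s) = 1/(2s) + (1 + γ)/2 + O(s)` near `0`). -/
theorem eulerSum_expansion_at_zero :
    ∃ H : ℂ → ℂ, AnalyticOnNhd ℂ H eulerSumDomain ∧
      (∀ s : ℂ, 1 < s.re →
        H s = ∑' n : ℕ, ((harmonic (n + 1) : ℚ) : ℂ) * ((n + 1 : ℕ) : ℂ) ^ (-s)) ∧
      Tendsto (fun s : ℂ => H s - 1 / (2 * s)) (𝓝[eulerSumDomain] 0)
        (𝓝 ((1 + (Real.eulerMascheroniConstant : ℂ)) / 2)) := by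
  exact ⟨EulerSumAux.HH, EulerSumAux.HH_analytic, EulerSumAux.HH_series, EulerSumAux.HH_tendsto⟩
end

section
/- The function s ↦ ζ(s + 1) − ψ(s)·ζ(s) − 1/(2s), defined for complex s ≠ 0 near 0 (with s avoiding the poles of ψ), tends to γ/2 + ζ′(0) as s → 0, where ζ is the Riemann zeta function, ζ′ its derivative, ψ(s) = Γ′(s)/Γ(s) the digamma function, and γ the Euler–Mascheroni constant. -/
open Complex Filter Topology

/-- The function `s ↦ ζ(s + 1) − ψ(s)·ζ(s) − 1/(2s)` tends to `γ/2 + ζ′(0)` as `s → 0`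
through nonzero complex values, where `ψ(s) = Γ′(s)/Γ(s)` and `γ` is the Euler–Mascheroni
constant. -/
theorem zeta_digamma_expansion_at_zero :
    Tendsto (fun s : ℂ =>
        riemannZeta (s + 1) - (deriv Complex.Gamma s / Complex.Gamma s) * riemannZeta s
          - 1 / (2 * s))
      (𝓝[≠] 0)
      (𝓝 ((Real.eulerMascheroniConstant : ℂ) / 2 + deriv riemannZeta 0)) := by
  have hshift : Tendsto (fun s : ℂ => s + 1) (𝓝[≠] 0) (𝓝[≠] 1) := by
    refine tendsto_nhdsWithin_iff.2 ⟨?_, ?_⟩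
    · have : Tendsto (fun s : ℂ => s + 1) (𝓝 0) (𝓝 (0 + 1)) :=
        (continuous_id.add continuous_const).tendsto 0
      rw [zero_add] at this
      exact this.mono_left nhdsWithin_le_nhds
    · filter_upwards [self_mem_nhdsWithin] with s hs
      simpa using hs
  have h1 := tendsto_riemannZeta_sub_one_div.comp hshift
  have hd : DifferentiableAt ℂ riemannZeta 0 := differentiableAt_riemannZeta (by norm_num)
  have h2 := hasDerivAt_iff_tendsto_slope.1 hd.hasDerivAt
  have h3 : Tendsto riemannZeta (𝓝[≠] 0) (𝓝 (riemannZeta 0)) :=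
    hd.continuousAt.tendsto.mono_left nhdsWithin_le_nhds
  have han : AnalyticAt ℂ Complex.Gamma 1 := by
    rw [Complex.analyticAt_iff_eventually_differentiableAt]
    have : ∀ᶠ z : ℂ in 𝓝 1, 0 < z.re :=
      (isOpen_lt continuous_const Complex.continuous_re).mem_nhds (by simp)
    filter_upwards [this] with z hz
    refine Complex.differentiableAt_Gamma z fun m h => ?_
    rw [h] at hz
    simp at hz
    have : (0 : ℝ) ≤ m := m.cast_nonneg
    linarith
  have hc : ContinuousAt Complex.digamma 1 :=
    han.deriv.continuousAt.div han.continuousAt (by simp)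
  have h4 := (hc.tendsto.mono_left nhdsWithin_le_nhds).comp hshift
  have h5 := (h1.sub (h4.mul h3)).add h2
  rw [Complex.digamma_one, riemannZeta_zero] at h5
  have hev : ∀ᶠ s : ℂ in 𝓝[≠] 0, -1 < s.re :=
    nhdsWithin_le_nhds
      ((isOpen_lt continuous_const Complex.continuous_re).mem_nhds (by simp))
  refine (h5.congr' ?_).trans_eq ?_
  · filter_upwards [self_mem_nhdsWithin, hev] with s hs hre
    have hs0 : s ≠ 0 := hs
    have hm : ∀ m : ℕ, s ≠ -m := by
      intro m h
      rcases Nat.eq_zero_or_pos m with rfl | hp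
      · simp at h; exact hs0 h
      · rw [h] at hre
        simp at hre
        omega
    have hdg := Complex.digamma_apply_add_one s hm
    have hdef : Complex.digamma s = deriv Complex.Gamma s / Complex.Gamma s := rfl
    simp only [Function.comp_apply, slope_def_field, riemannZeta_zero]
    rw [hdg, ← hdef]
    field_simp
    ring_nf
    try field_simp
    try ring
  · congr 1; ring
end
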